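/- Let R be a Noetherian ring and M a finitely generated R-module. Let 𝒜 be the set of minimal primes p of the support of M such that ht p ≥ 2 and R_p is excellent and equidimensional with no embedded primes, and assume 𝒜 ≠ ∅. Then there exist a finitely generated free R-module H and finitely generated submodules L ⊆ T ⊆ H (hence L and T are torsionless) such that M ≅ T/L and, for every p ∈ 𝒜, the localization T_p is contained in (L_p)⁻_{H_p}, i.e., T_p is integral over L_p in the free R_p-module H_p. -/

import Mathlib

/- # Liftable integral closure: core definitions

Free $R$-modules are modeled as `ι →₀ R`, and the symmetric algebra of `ι →₀ R`
is modeled as `MvPolynomial ι R`, with the canonical degree-one embedding sending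
the basis vector at `i` to the variable `X i`. -/

noncomputable section

open scoped TensorProduct

namespace LIC

variable (R : Type*) [CommRing R]

/-- The canonical embedding of the free module `ι →₀ R` onto the degree-one part of its
symmetric algebra `MvPolynomial ι R`. -/
def symEmb (ι : Type*) : (ι →₀ R) →ₗ[R] MvPolynomial ι R :=
  Finsupp.linearCombination R MvPolynomial.X

variable {R}

/-- The integral closure `U⁻_F` of a submodule `U` of the free module `F = ι →₀ R`:
the degree-one part of the integral closure, inside the symmetric algebra of `F`,
of the subalgebra generated by `U`. -/
def freeIC {ι : Type*} (U : Submodule R (ι →₀ R)) : Submodule R (ι →₀ R) where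
  carrier := {x | IsIntegral (Algebra.adjoin R (symEmb R ι '' U)) (symEmb R ι x)}
  zero_mem' := by simpa using isIntegral_zero
  add_mem' := by
    intro a b ha hb
    simpa [map_add] using ha.add hb
  smul_mem' := by
    intro c x hx
    have hc : IsIntegral (Algebra.adjoin R (symEmb R ι '' ↑U))
        ((algebraMap R (MvPolynomial ι R)) c) := by
      have : (algebraMap R (MvPolynomial ι R)) c
          = algebraMap (Algebra.adjoin R (symEmb R ι '' ↑U)) (MvPolynomial ι R)
            ⟨(algebraMap R (MvPolynomial ι R)) c,
              Subalgebra.algebraMap_mem _ c⟩ := rfl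
      rw [this]
      exact isIntegral_algebraMap
    have : symEmb R ι (c • x) = (algebraMap R (MvPolynomial ι R)) c * symEmb R ι x := by
      rw [map_smul, Algebra.smul_def]
    simpa [Set.mem_setOf_eq, this] using hc.mul hx
  
/-- The liftable integral closure `lic(L, M)` of a submodule `L ⊆ M`, computed via the
canonical free presentation `M →₀ R ↠ M`.  (By `LIC.lic_indep` this agrees with the
closure computed from any surjection of a free module onto `M`.) -/
def lic {M : Type*} [AddCommGroup M] [Module R M] (L : Submodule R M) : Submodule R M :=
  Submodule.map (Finsupp.linearCombination R (id : M → M))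
    (freeIC (Submodule.comap (Finsupp.linearCombination R (id : M → M)) L))

end LIC

end

namespace LIC

open scoped TensorProduct

/-- A regular local ring: a Noetherian local ring whose maximal ideal can be generated by
`dim R` elements. -/
def IsRegularLocalRing (A : Type*) [CommRing A] : Prop :=
  IsNoetherianRing A ∧ ∃ _ : IsLocalRing A, ∃ s : Finset A,
    Ideal.span (s : Set A) = IsLocalRing.maximalIdeal A ∧
    (s.card : WithBot ℕ∞) = ringKrullDim A

/-- A regular ring: all localizations at primes are regular local rings. -/
def IsRegularRing (A : Type*) [CommRing A] : Prop :=
  ∀ (q : Ideal A) (_ : q.IsPrime), IsRegularLocalRing (Localization.AtPrime q)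

universe v

/-- An `R`-algebra `S` has geometrically regular fibers if for every prime `p ⊆ R` and
every finite field extension `K` of the residue field `κ(p) = Frac(R/p)`, the
base-changed fiber `K ⊗_R S` is a regular ring. -/
def HasGeometricallyRegularFibers (R : Type*) (S : Type*) [CommRing R] [CommRing S]
    [Algebra R S] : Prop :=
  ∀ (p : Ideal R) (_ : p.IsPrime)
    (K : Type v) (_ : Field K) (_ : Algebra (R ⧸ p) K) (_ : NoZeroSMulDivisors (R ⧸ p) K)
    (_ : Algebra R K) (_ : IsScalarTower R (R ⧸ p) K),
    (letI := FractionRing.liftAlgebra (R ⧸ p) K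
     FiniteDimensional (FractionRing (R ⧸ p)) K) →
    IsRegularRing (K ⊗[R] S)

/-- A catenary ring: any two saturated chains of primes with the same endpoints have the
same length. -/
def IsCatenaryRing (A : Type*) [CommRing A] : Prop :=
  ∀ c d : LTSeries (PrimeSpectrum A),
    c.head = d.head → c.last = d.last →
    (∀ i : Fin c.length, c.toFun i.castSucc ⋖ c.toFun i.succ) →
    (∀ i : Fin d.length, d.toFun i.castSucc ⋖ d.toFun i.succ) →
    c.length = d.length

universe u

/-- A G-ring: for every prime `p`, the formal fibers of `R_p` (the fibers of the map from
`R_p` to its maximal-adic completion) are geometrically regular. -/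
def IsGRing (R : Type u) [CommRing R] : Prop :=
  ∀ (p : Ideal R) (_ : p.IsPrime),
    HasGeometricallyRegularFibers.{u} (Localization.AtPrime p)
      (AdicCompletion (IsLocalRing.maximalIdeal (Localization.AtPrime p))
        (Localization.AtPrime p))

/-- J-2: for every finite-type `R`-algebra, the regular locus of its prime spectrum is
open. -/
def IsJ2 (R : Type u) [CommRing R] : Prop :=
  ∀ (A : Type u) (_ : CommRing A) (_ : Algebra R A), Algebra.FiniteType R A →
    IsOpen {q : PrimeSpectrum A | IsRegularLocalRing (Localization.AtPrime q.asIdeal)}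

/-- Universally catenary: every finite-type `R`-algebra is catenary. -/
def IsUniversallyCatenary (R : Type u) [CommRing R] : Prop :=
  ∀ (A : Type u) (_ : CommRing A) (_ : Algebra R A), Algebra.FiniteType R A →
    IsCatenaryRing A

/-- An excellent ring: a universally catenary Noetherian G-ring satisfying J-2. -/
def IsExcellentRing (R : Type u) [CommRing R] : Prop :=
  IsNoetherianRing R ∧ IsUniversallyCatenary R ∧ IsGRing R ∧ IsJ2 R

open CategoryTheory in
/-- A Gorenstein local ring: a Noetherian local ring having finite injective dimension
over itself, i.e. admitting a finite-length injective resolution of itself. -/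
def IsGorensteinLocalRing (S : Type u) [CommRing S] : Prop :=
  IsNoetherianRing S ∧ IsLocalRing S ∧
  ∃ (I : InjectiveResolution (ModuleCat.of S S)) (n : ℕ),
    ∀ m, n ≤ m → Limits.IsZero (I.cocomplex.X m)

/-- A local ring is equidimensional if `dim (R/p) = dim R` for every minimal prime `p`. -/
def IsEquidimensionalRing (R : Type*) [CommRing R] : Prop :=
  ∀ p ∈ minimalPrimes R, ringKrullDim (R ⧸ p) = ringKrullDim R

/-- A ring has no embedded primes if every associated prime (of `R` as a module over
itself) is a minimal prime. -/
def HasNoEmbeddedPrimes (R : Type*) [CommRing R] : Prop :=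
  ∀ p : Ideal R, IsAssociatedPrime p R → p ∈ minimalPrimes R

end LIC

namespace LIC

universe u

variable {R : Type u} [CommRing R]

/-- The canonical localization map `(Fin n →₀ R) → (Fin n →₀ R_p)` on free modules. -/
noncomputable def locMap (p : Ideal R) [p.IsPrime] (n : ℕ) :
    (Fin n →₀ R) →ₗ[R] (Fin n →₀ Localization.AtPrime p) :=
  Finsupp.mapRange.linearMap (Algebra.linearMap R (Localization.AtPrime p))

/-- `T_p ⊆ (L_p)⁻_{H_p}`: after localizing at `p`, the submodule generated by `T` is
contained in the integral closure, in the free `R_p`-module `H_p = Fin n →₀ R_p`, of the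
localization `L_p` (the `R_p`-span of the image of `L`). -/
def LocalizedIntegral (p : Ideal R) [p.IsPrime] {n : ℕ}
    (L T : Submodule R (Fin n →₀ R)) : Prop :=
  ∀ x ∈ T, locMap p n x ∈
    freeIC (Submodule.span (Localization.AtPrime p) (locMap p n '' (L : Set (Fin n →₀ R))))

/-- The condition on a prime `p` from Statement 19: `ht p ≥ 2` (i.e. `dim R_p ≥ 2`) and
`R_p` is excellent, equidimensional and without embedded primes. -/
def GoodPrime (p : Ideal R) [p.IsPrime] : Prop :=
  2 ≤ ringKrullDim (Localization.AtPrime p) ∧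
  IsExcellentRing.{u} (Localization.AtPrime p) ∧
  IsEquidimensionalRing (Localization.AtPrime p) ∧
  HasNoEmbeddedPrimes (Localization.AtPrime p)

end LIC


namespace LICP

open IsLocalRing

/-- `f : B → C` behaves like the completion of a Noetherian local ring. -/
structure CL {B C : Type*} [CommRing B] [CommRing C] [IsLocalRing B] (f : B →+* C) : Prop where
  noeth : IsNoetherianRing C
  loc : IsLocalRing C
  jac : ∀ x ∈ (maximalIdeal B).map f, x ∈ nonunits C
  dense : ∀ (j : ℕ) (c : C), ∃ b : B, c - f b ∈ ((maximalIdeal B).map f) ^ j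
  sep : ∀ (j : ℕ) (b : B), f b ∈ ((maximalIdeal B).map f) ^ j → b ∈ maximalIdeal B ^ j
  lim : ∀ b : ℕ → B, (∀ j, b (j + 1) - b j ∈ maximalIdeal B ^ j) →
    ∃ c : C, ∀ j, c - f (b j) ∈ ((maximalIdeal B).map f) ^ j

/-- Ideals of a Noetherian local ring are closed. -/
theorem closed_ideal {C : Type*} [CommRing C] [IsNoetherianRing C] [IsLocalRing C]
    (I M : Ideal C) (hM : M ≤ maximalIdeal C) (c : C) (h : ∀ j, c ∈ I ⊔ M ^ j) : c ∈ I := by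
  have key := Ideal.iInf_pow_smul_eq_bot_of_isLocalRing (R := C) (M := C ⧸ I) M
    (fun h => by
      rw [h] at hM
      exact (maximalIdeal.isMaximal C).ne_top (top_le_iff.mp hM))
  have : (Ideal.Quotient.mk I c) ∈ (⨅ i : ℕ, M ^ i • (⊤ : Submodule C (C ⧸ I))) := by
    rw [Submodule.mem_iInf]
    intro i
    obtain ⟨a, ha, b, hb, hab⟩ := Submodule.mem_sup.mp (h i)
    have e : Ideal.Quotient.mk I c = b • (1 : C ⧸ I) := by
      rw [← hab, map_add, Ideal.Quotient.eq_zero_iff_mem.mpr ha, zero_add, Algebra.smul_def, mul_one]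
      rfl
    rw [e]
    exact Submodule.smul_mem_smul hb trivial
  rw [key] at this
  exact Ideal.Quotient.eq_zero_iff_mem.mp (by simpa using this)

/-- Artin-Rees for a nonzerodivisor. -/
theorem ar_nzd {B : Type*} [CommRing B] [IsNoetherianRing B] (m : Ideal B) (y : B)
    (hy : ∀ b, y * b = 0 → b = 0) :
    ∃ k, ∀ n b, y * b ∈ m ^ (n + k) → b ∈ m ^ n := by
  obtain ⟨k, hk⟩ := Ideal.exists_pow_inf_eq_pow_smul (R := B) (M := B) m (Ideal.span {y})
  refine ⟨k, fun n b hb => ?_⟩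
  have h := hk (n + k) (by omega)
  have h1 : y * b ∈ (m ^ (n + k) • ⊤ ⊓ Ideal.span {y} : Submodule B B) := by
    refine ⟨?_, Ideal.mul_mem_right _ _ (Ideal.mem_span_singleton_self y)⟩
    simpa using hb
  rw [h, Nat.add_sub_cancel] at h1
  have h2 : y * b ∈ (m ^ n • Ideal.span {y} : Submodule B B) :=
    Submodule.smul_mono le_rfl inf_le_right h1
  rw [smul_eq_mul, mul_comm, Ideal.mem_span_singleton_mul] at h2
  obtain ⟨z, hz, hzb⟩ := h2
  have : b - z = 0 := hy _ (by rw [mul_sub, hzb, sub_self])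
  rw [sub_eq_zero.mp this]; exact hz

namespace CL

variable {B C : Type*} [CommRing B] [CommRing C] [IsLocalRing B] {f : B →+* C}

theorem le_max [IsLocalRing C] (h : CL f) : (maximalIdeal B).map f ≤ maximalIdeal C :=
  fun x hx => h.jac x hx

theorem max_eq [IsLocalRing C] (h : CL f) : (maximalIdeal B).map f = maximalIdeal C := by
  refine le_antisymm h.le_max fun x hx => ?_
  obtain ⟨b, hb⟩ := h.dense 1 x
  rw [pow_one] at hb
  have hfb : f b ∈ maximalIdeal C := by
    have := sub_mem hx (h.le_max hb)
    simpa using this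
  have : b ∈ maximalIdeal B := by
    by_contra hn
    have hu : IsUnit b := by simpa using hn
    exact hfb (hu.map f)
  have := add_mem hb (Ideal.mem_map_of_mem f this)
  simpa using this

theorem approx (h : CL f) (I : Ideal B) (j : ℕ) (c : C) (hc : c ∈ I.map f) :
    ∃ i ∈ I, c - f i ∈ ((maximalIdeal B).map f) ^ j := by
  refine Submodule.span_induction ?_ ?_ ?_ ?_ hc
  · rintro _ ⟨i, hi, rfl⟩
    exact ⟨i, hi, by simp⟩
  · exact ⟨0, I.zero_mem, by simp⟩
  · rintro x y - - ⟨i, hi, hxi⟩ ⟨i', hi', hyi⟩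
    refine ⟨i + i', I.add_mem hi hi', ?_⟩
    have := add_mem hxi hyi
    rw [map_add]; convert this using 1; ring
  · rintro a x - ⟨i, hi, hxi⟩
    obtain ⟨b, hb⟩ := h.dense j a
    refine ⟨b * i, I.mul_mem_left _ hi, ?_⟩
    have := add_mem (Ideal.mul_mem_left _ a hxi) (Ideal.mul_mem_left _ (f i) hb)
    rw [map_mul, smul_eq_mul]; convert this using 1; ring

theorem contr [IsNoetherianRing B] (h : CL f) (I : Ideal B) (b : B) (hb : f b ∈ I.map f) :
    b ∈ I := by
  refine closed_ideal I (maximalIdeal B) le_rfl b fun j => ?_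
  obtain ⟨i, hi, hbi⟩ := h.approx I j _ hb
  rw [← map_sub] at hbi
  have := add_mem (Ideal.mem_sup_left hi : i ∈ I ⊔ maximalIdeal B ^ j)
    (Ideal.mem_sup_right (h.sep _ _ hbi))
  simpa using this

theorem eq_zero (h : CL f) (c : C) (hc : ∀ j, c ∈ ((maximalIdeal B).map f) ^ j) : c = 0 := by
  have := h.noeth
  have := h.loc
  have := closed_ideal (⊥ : Ideal C) _ h.le_max c (fun j => Ideal.mem_sup_right (hc j))
  simpa using this

theorem nzd [IsNoetherianRing B] (h : CL f) (y : B) (hy : ∀ b, y * b = 0 → b = 0) (c : C)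
    (hc : f y * c = 0) : c = 0 := by
  obtain ⟨k, hk⟩ := ar_nzd (maximalIdeal B) y hy
  refine h.eq_zero c fun n => ?_
  obtain ⟨b, hb⟩ := h.dense (n + k) c
  have h1 : f (y * b) ∈ ((maximalIdeal B).map f) ^ (n + k) := by
    have := Ideal.mul_mem_left _ (- f y) hb
    rw [mul_sub, neg_mul, hc] at this
    simpa using this
  have h2 := hk n b (h.sep _ _ h1)
  have h3 : f b ∈ ((maximalIdeal B).map f) ^ n := by
    rw [← Ideal.map_pow]; exact Ideal.mem_map_of_mem f h2
  have h4 := Ideal.pow_le_pow_right (show n ≤ n + k by omega) hb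
  simpa using add_mem h4 h3

theorem comp_equiv {B' : Type*} [CommRing B'] [IsLocalRing B'] (h : CL f) (e : B' ≃+* B) :
    CL (f.comp (e : B' →+* B)) := by
  have hm : (maximalIdeal B').map (e : B' →+* B) = maximalIdeal B := by
    ext x
    constructor
    · intro hx
      have : (maximalIdeal B').map (e : B' →+* B) ≤ maximalIdeal B := by
        rw [Ideal.map_le_iff_le_comap]
        intro y hy
        simp only [Ideal.mem_comap, mem_maximalIdeal, mem_nonunits_iff] at hy ⊢
        intro hu
        exact hy (by simpa using hu.map e.symm)
      exact this hx
    · intro hx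
      have : e.symm x ∈ maximalIdeal B' := by
        simp only [mem_maximalIdeal, mem_nonunits_iff] at hx ⊢
        intro hu
        exact hx (by simpa using hu.map e)
      simpa using Ideal.mem_map_of_mem (e : B' →+* B) this
  have hm' : (maximalIdeal B').map (f.comp (e : B' →+* B)) = (maximalIdeal B).map f := by
    rw [← Ideal.map_map, hm]
  have hmp : ∀ j x, e x ∈ maximalIdeal B ^ j ↔ x ∈ maximalIdeal B' ^ j := by
    intro j x
    rw [← hm, ← Ideal.map_pow]
    constructor
    · intro hx
      rw [Ideal.mem_map_iff_of_surjective (e : B' →+* B) e.surjective] at hx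
      obtain ⟨y, hy, hyx⟩ := hx
      rw [← e.injective hyx]; exact hy
    · intro hx; exact Ideal.mem_map_of_mem (e : B' →+* B) hx
  refine ⟨h.noeth, h.loc, ?_, ?_, ?_, ?_⟩
  · rw [hm']; exact h.jac
  · rw [hm']
    intro j c
    obtain ⟨b, hb⟩ := h.dense j c
    exact ⟨e.symm b, by simpa using hb⟩
  · rw [hm']
    intro j b hb
    rw [← hmp]; exact h.sep j _ hb
  · rw [hm']
    intro b hb
    exact h.lim (fun j => e (b j)) (fun j => by rw [← map_sub, hmp]; exact hb j)

end CL
end LICP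

namespace LICP

open IsLocalRing Polynomial

theorem pseudo_div {B : Type*} [CommRing B] (y a : B) (F : B[X]) :
    ∃ (e : ℕ) (G : B[X]) (r : B), C (y ^ e) * F = (C y * X - C a) * G + C r := by
  induction F using Polynomial.induction_on with
  | C b => exact ⟨0, 0, b, by simp⟩
  | add p q hp hq =>
    obtain ⟨e, G, r, h⟩ := hp
    obtain ⟨e', G', r', h'⟩ := hq
    refine ⟨e + e', C (y ^ e') * G + C (y ^ e) * G', y ^ e' * r + y ^ e * r', ?_⟩
    simp only [map_add, map_mul, pow_add]
    linear_combination C (y ^ e') * h + C (y ^ e) * h'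
  | monomial n b hn =>
    obtain ⟨e, G, r, h⟩ := hn
    refine ⟨e + 1, C y * X * G + C r, a * r, ?_⟩
    simp only [map_mul, pow_succ]
    linear_combination C y * X * h

theorem no_between {B : Type*} [CommRing B] [IsDomain B] (y a : B) (hy : y ≠ 0)
    (q p : Ideal B[X]) [p.IsPrime] (hq : ∀ b : B, C b ∈ q → b = 0)
    (hya : C y * X - C a ∈ q) (hpq : p < q) : p = ⊥ := by
  have hyp : ∀ e, C (y ^ e) ∉ p := fun e h => pow_ne_zero e hy (hq _ (hpq.le h))
  by_cases hya' : C y * X - C a ∈ p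
  · exfalso
    apply hpq.not_ge
    intro F hF
    obtain ⟨e, G, r, h⟩ := pseudo_div y a F
    have : C r ∈ q := by
      have h1 : C r = C (y ^ e) * F - (C y * X - C a) * G := by rw [h]; ring
      rw [h1]
      exact sub_mem (q.mul_mem_left _ hF) (q.mul_mem_right _ hya)
    rw [hq r this, C_0, add_zero] at h
    have h2 : C (y ^ e) * F ∈ p := by rw [h]; exact p.mul_mem_right _ hya'
    exact (Ideal.IsPrime.mem_or_mem ‹_› h2).resolve_left (hyp e)
  · rw [eq_bot_iff]
    suffices H : ∀ n (F : B[X]), F.natDegree ≤ n → F ∈ p → F = 0 from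
      fun F hF => H _ F le_rfl hF
    have hd : (C y * X - C a).natDegree = 1 := by
      rw [sub_eq_add_neg, ← C_neg]; exact natDegree_linear hy
    have step : ∀ F : B[X], F ∈ p → F ≠ 0 → ∃ G ∈ p, G ≠ 0 ∧ G.natDegree + 1 = F.natDegree := by
      intro F hF hF0
      obtain ⟨e, G, r, h⟩ := pseudo_div y a F
      have : C r ∈ q := by
        have h1 : C r = C (y ^ e) * F - (C y * X - C a) * G := by rw [h]; ring
        rw [h1]
        exact sub_mem (q.mul_mem_left _ (hpq.le hF)) (q.mul_mem_right _ hya)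
      rw [hq r this, C_0, add_zero] at h
      have h2 : (C y * X - C a) * G ∈ p := by rw [← h]; exact p.mul_mem_left _ hF
      have hG := (Ideal.IsPrime.mem_or_mem ‹_› h2).resolve_left hya'
      have hye : (C (y ^ e) : B[X]) ≠ 0 := by rw [Ne, C_eq_zero]; exact pow_ne_zero e hy
      have hG0 : G ≠ 0 := by
        rintro rfl
        rw [mul_zero] at h
        exact (mul_ne_zero hye hF0) h
      refine ⟨G, hG, hG0, ?_⟩
      have h3 := congrArg natDegree h
      have hl : (C y * X - C a : B[X]) ≠ 0 := by
        intro h0; rw [h0] at hd; simp at hd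
      rw [natDegree_mul hye hF0, natDegree_mul hl hG0, hd, natDegree_C] at h3
      omega
    intro n
    induction n with
    | zero =>
      intro F hF hFp
      by_contra h0
      obtain ⟨G, -, -, h⟩ := step F hFp h0
      omega
    | succ n ih =>
      intro F hF hFp
      by_contra h0
      obtain ⟨G, h1, h2, h⟩ := step F hFp h0
      exact h2 (ih G (by omega) h1)

structure BadData (B : Type*) [CommRing B] [IsLocalRing B] (y a : B) (l : ℕ) (q : Ideal B[X]) :
    Prop where
  y0 : y ≠ 0
  ym : y ∈ maximalIdeal B
  h1 : ∀ w ∈ maximalIdeal B ^ l, ∃ b', w * a = y * b' ∧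
    b' ∈ Ideal.span {y} ⊔ maximalIdeal B ^ (l + 1)
  h2 : ∃ β ∈ maximalIdeal B, a ^ 2 - y * a = y ^ 2 * β
  prime : q.IsPrime
  q0 : ∀ b : B, C b ∈ q → b = 0
  qya : C y * X - C a ∈ q
  q1 : ∀ φ ∈ q, φ.eval 1 ∈ maximalIdeal B

theorem BadData.minimal {B : Type*} [CommRing B] [IsDomain B] [IsNoetherianRing B] [IsLocalRing B]
    {y a : B} {l : ℕ} {q : Ideal B[X]} (D : BadData B y a l q) :
    (maximalIdeal B).comap (evalRingHom 1) ∈ (q ⊔ Ideal.span {C y}).minimalPrimes := by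
  have hq := D.prime
  set n : Ideal B[X] := (maximalIdeal B).comap (evalRingHom 1) with hn
  have hnp : n.IsPrime := Ideal.comap_isPrime _ _
  have hCn : ∀ b ∈ maximalIdeal B, C b ∈ n := by
    intro b hb; rw [hn, Ideal.mem_comap]; simpa using hb
  have hyq : C y ∉ q := fun h => D.y0 (D.q0 _ h)
  refine ⟨⟨hnp, ?_⟩, ?_⟩
  · refine sup_le (fun φ hφ => D.q1 φ hφ) ?_
    rw [Ideal.span_singleton_le_iff_mem]
    exact hCn _ D.ym
  rintro p ⟨hp, hqyp⟩ hpn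
  have hqp : q ≤ p := le_sup_left.trans hqyp
  have hyp : C y ∈ p := hqyp (Ideal.mem_sup_right (Ideal.mem_span_singleton_self _))
  have hXn : (X : B[X]) ∉ n := by
    rw [hn, Ideal.mem_comap]; simp
  have hXp : (X : B[X]) ∉ p := fun h => hXn (hpn h)
  -- w X ∈ p + m^(l+1)
  have hw : ∀ w ∈ maximalIdeal B ^ l, ∃ e ∈ maximalIdeal B ^ (l + 1), C w * X - C e ∈ p := by
    intro w hw
    obtain ⟨b', h, hb'⟩ := D.h1 w hw
    obtain ⟨d', hd', e, he, hde⟩ := Submodule.mem_sup.mp hb'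
    obtain ⟨d, rfl⟩ := Ideal.mem_span_singleton'.mp hd'
    refine ⟨e, he, ?_⟩
    have h3 : C w * X - C b' ∈ q := by
      have h4 : C y * (C w * X - C b') ∈ q := by
        have h' := congrArg (C : B → B[X]) h
        simp only [map_mul] at h'
        have : C y * (C w * X - C b') = C w * (C y * X - C a) := by
          linear_combination h'
        rw [this]; exact q.mul_mem_left _ D.qya
      exact (hq.mem_or_mem h4).resolve_left hyq
    have : C w * X - C e = (C w * X - C b') + C d * C y := by
      rw [← hde]; simp only [map_add, map_mul]; ring
    rw [this]
    exact add_mem (hqp h3) (p.mul_mem_left _ hyp)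
  let S := Localization.AtPrime n
  let I : Ideal S := (maximalIdeal B ^ l).map ((algebraMap B[X] S).comp C)
  have hXu : IsUnit (algebraMap B[X] S X) :=
    IsLocalization.map_units S (⟨X, hXn⟩ : n.primeCompl)
  have hI : I ≤ p.map (algebraMap B[X] S) := by
    refine Submodule.le_of_le_smul_of_le_jacobson_bot (I := maximalIdeal S)
      (IsNoetherian.noetherian I) (by rw [IsLocalRing.jacobson_eq_maximalIdeal _ bot_ne_top]) ?_
    rw [Ideal.map_le_iff_le_comap]
    intro w hw'
    obtain ⟨e, he, hwe⟩ := hw w hw'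
    rw [Ideal.mem_comap]
    have h5 : algebraMap B[X] S (C w * X) ∈ p.map (algebraMap B[X] S) ⊔ maximalIdeal S • I := by
      have : C w * X = (C w * X - C e) + C e := by ring
      rw [this, map_add]
      refine add_mem (Ideal.mem_sup_left (Ideal.mem_map_of_mem _ hwe)) (Ideal.mem_sup_right ?_)
      have h6 : (maximalIdeal B ^ (l + 1)).map ((algebraMap B[X] S).comp C) ≤ maximalIdeal S • I := by
        rw [pow_succ', Ideal.map_mul, smul_eq_mul]
        refine Ideal.mul_mono ?_ le_rfl
        rw [Ideal.map_le_iff_le_comap]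
        intro b hb
        rw [Ideal.mem_comap]
        have := Ideal.mem_map_of_mem (algebraMap B[X] S) (hCn b hb)
        rw [← Localization.AtPrime.map_eq_maximalIdeal]
        exact this
      exact h6 (Ideal.mem_map_of_mem _ he)
    rw [map_mul, mul_comm] at h5
    exact (Ideal.unit_mul_mem_iff_mem _ hXu).mp h5
  have hmp : ∀ b ∈ maximalIdeal B, C b ∈ p := by
    intro b hb
    have h7 : ((algebraMap B[X] S).comp C) (b ^ l) ∈ p.map (algebraMap B[X] S) :=
      hI (Ideal.mem_map_of_mem _ (Ideal.pow_mem_pow hb l))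
    rw [RingHom.comp_apply, IsLocalization.algebraMap_mem_map_algebraMap_iff n.primeCompl] at h7
    obtain ⟨s, hs, h8⟩ := h7
    have h9 := (hp.mem_or_mem h8).resolve_left (fun h => hs (hpn h))
    rw [C_pow] at h9
    exact hp.mem_of_pow_mem _ h9
  obtain ⟨β, hβ, h2⟩ := D.h2
  have hX2 : (X : B[X]) ^ 2 - X - C β ∈ q := by
    have h4 : C y ^ 2 * (X ^ 2 - X - C β) ∈ q := by
      have h' := congrArg (C : B → B[X]) h2
      simp only [map_mul, map_sub, map_pow] at h'
      have : C y ^ 2 * (X ^ 2 - X - C β) = (C y * X - C a) * (C y * X + C a - C y) := by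
        linear_combination h'
      rw [this]; exact q.mul_mem_right _ D.qya
    exact (hq.mem_or_mem h4).resolve_left (fun h => hyq (hq.mem_of_pow_mem _ h))
  have hX1 : (X : B[X]) - C 1 ∈ p := by
    have h5 : (X : B[X]) * (X - C 1) ∈ p := by
      have : (X : B[X]) * (X - C 1) = (X ^ 2 - X - C β) + C β := by rw [C_1]; ring
      rw [this]; exact add_mem (hqp hX2) (hmp _ hβ)
    exact (hp.mem_or_mem h5).resolve_left hXp
  intro φ hφ
  obtain ⟨ψ, hψ⟩ := X_sub_C_dvd_sub_C_eval (a := (1 : B)) (p := φ)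
  have : φ = (X - C 1) * ψ + C (φ.eval 1) := by rw [← hψ]; ring
  rw [this]
  exact add_mem (p.mul_mem_right _ hX1) (hmp _ (by simpa [hn] using hφ))

theorem BadData.false {B : Type*} [CommRing B] [IsDomain B] [IsNoetherianRing B] [IsLocalRing B]
    {y a : B} {l : ℕ} {q : Ideal B[X]} (D : BadData B y a l q)
    (hcat : LIC.IsCatenaryRing B[X]) (hdim : 2 ≤ ringKrullDim B) : False := by
  have hq := D.prime
  have hmin := D.minimal
  set n : Ideal B[X] := (maximalIdeal B).comap (evalRingHom 1) with hn
  have hnp : n.IsPrime := Ideal.comap_isPrime _ _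
  let b0 : PrimeSpectrum B[X] := ⟨⊥, Ideal.isPrime_bot⟩
  let q0 : PrimeSpectrum B[X] := ⟨q, hq⟩
  let n0 : PrimeSpectrum B[X] := ⟨n, hnp⟩
  have hCn : ∀ b ∈ maximalIdeal B, C b ∈ n := by
    intro b hb; rw [hn, Ideal.mem_comap]; simpa using hb
  have hyq : C y ∉ q := fun h => D.y0 (D.q0 _ h)
  have hbq : b0 ⋖ q0 := by
    constructor
    · change (⊥ : Ideal B[X]) < q
      rw [bot_lt_iff_ne_bot]
      rintro rfl
      have := D.qya
      rw [Ideal.mem_bot] at this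
      have h := congrArg (fun p => p.coeff 1) this
      simp [coeff_C] at h
      exact D.y0 h
    · intro p hbp hpq
      have : p.asIdeal < q := hpq
      have h := no_between y a D.y0 q p.asIdeal D.q0 D.qya this
      have hbp' : (⊥ : Ideal B[X]) < p.asIdeal := hbp
      exact hbp'.ne' h
  have hqn : q0 ⋖ n0 := by
    constructor
    · refine lt_of_le_of_ne (fun φ hφ => D.q1 φ hφ) ?_
      intro h
      have h' : q = n := congrArg PrimeSpectrum.asIdeal h
      exact hyq (h' ▸ hCn _ D.ym)
    · intro p hqp hpn
      have h1 := Ideal.map_height_le_one_of_mem_minimalPrimes hmin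
      have hqp' : q < p.asIdeal := hqp
      have hpn' : p.asIdeal < n := hpn
      have hk : ∀ J : Ideal B[X], RingHom.ker (Ideal.Quotient.mk q) ≤ J ↔ q ≤ J := by
        intro J; rw [Ideal.mk_ker]
      have hP : (p.asIdeal.map (Ideal.Quotient.mk q)).IsPrime :=
        Ideal.map_isPrime_of_surjective Ideal.Quotient.mk_surjective ((hk _).mpr hqp'.le)
      have hN : (n.map (Ideal.Quotient.mk q)).IsPrime :=
        Ideal.map_isPrime_of_surjective Ideal.Quotient.mk_surjective ((hk _).mpr (hqp'.trans hpn').le)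
      have hcm : ∀ J : Ideal B[X], q ≤ J → (J.map (Ideal.Quotient.mk q)).comap (Ideal.Quotient.mk q) = J := by
        intro J hJ
        rw [Ideal.comap_map_of_surjective _ Ideal.Quotient.mk_surjective, ← RingHom.ker_eq_comap_bot,
          Ideal.mk_ker, sup_eq_left.mpr hJ]
      have hlt : p.asIdeal.map (Ideal.Quotient.mk q) < n.map (Ideal.Quotient.mk q) := by
        refine lt_of_le_of_ne (Ideal.map_mono hpn'.le) fun h => hpn'.ne ?_
        rw [← hcm _ hqp'.le, h, hcm _ (hqp'.trans hpn').le]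
      have hb : (⊥ : Ideal (B[X] ⧸ q)) < p.asIdeal.map (Ideal.Quotient.mk q) := by
        rw [bot_lt_iff_ne_bot]
        intro h
        apply hqp'.ne
        rw [← hcm _ hqp'.le, h, ← RingHom.ker_eq_comap_bot, Ideal.mk_ker]
      have h2 := Ideal.height_strict_mono_of_isPrime hlt
      have h3 := Ideal.height_strict_mono_of_isPrime hb
      have h4 := h2.trans_le h1
      have h5 : (p.asIdeal.map (Ideal.Quotient.mk q)).height = 0 := by
        exact Order.lt_one_iff.mp h4
      rw [h5] at h3
      exact absurd h3 (by simp)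
  obtain ⟨P1, hP1, hb1, h1m⟩ : ∃ P1 : Ideal B, P1.IsPrime ∧ ⊥ < P1 ∧ P1 < maximalIdeal B := by
    obtain ⟨c, hc⟩ := (Order.le_krullDim_iff (n := 2)).mp hdim
    refine ⟨(c ⟨1, by omega⟩).asIdeal, (c _).2, ?_, ?_⟩
    · exact lt_of_le_of_lt bot_le (show (c ⟨0, by omega⟩).asIdeal < _ from
        c.strictMono (show (⟨0, _⟩ : Fin (c.length + 1)) < ⟨1, _⟩ from Fin.mk_lt_mk.mpr (by omega)))
    · exact lt_of_lt_of_le (show _ < (c ⟨2, by omega⟩).asIdeal from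
        c.strictMono (show (⟨1, _⟩ : Fin (c.length + 1)) < ⟨2, _⟩ from Fin.mk_lt_mk.mpr (by omega)))
        (le_maximalIdeal (c _).2.ne_top)
  have hCm : ∀ (J : Ideal B) (b : B), C b ∈ J.map (C : B →+* B[X]) ↔ b ∈ J := by
    intro J b
    rw [Ideal.mem_map_C_iff]
    constructor
    · intro h; simpa using h 0
    · intro h k; rw [coeff_C]; split_ifs
      · exact h
      · exact J.zero_mem
  let p0 : PrimeSpectrum B[X] := ⟨P1.map C, inferInstance⟩
  let m0 : PrimeSpectrum B[X] := ⟨(maximalIdeal B).map C, inferInstance⟩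
  have l1 : b0 < p0 := by
    change (⊥ : Ideal B[X]) < P1.map C
    rw [bot_lt_iff_ne_bot]
    intro h
    apply hb1.ne'
    rw [eq_bot_iff]
    intro x hx
    have := (hCm P1 x).mpr hx
    rw [h] at this
    simpa using this
  have l2 : p0 < m0 := by
    change P1.map C < (maximalIdeal B).map C
    refine lt_of_le_of_ne (Ideal.map_mono h1m.le) fun h => h1m.not_ge ?_
    intro x hx
    rw [← hCm, h, hCm]; exact hx
  have l3 : m0 < n0 := by
    change (maximalIdeal B).map C < n
    refine lt_of_le_of_ne ?_ ?_
    · rw [Ideal.map_le_iff_le_comap]; exact fun b hb => hCn b hb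
    · intro h
      have h1 : (X : B[X]) - C 1 ∈ n := by rw [hn, Ideal.mem_comap]; simp
      rw [← h, Ideal.mem_map_C_iff] at h1
      have := h1 1
      simp [coeff_C, coeff_X, coeff_one] at this
  let s : LTSeries (PrimeSpectrum B[X]) := ⟨3, ![b0, p0, m0, n0], by
    intro i
    fin_cases i
    · exact l1
    · exact l2
    · exact l3⟩
  have hwf : WellFoundedLT (PrimeSpectrum B[X]) := by
    have hm : StrictMono (fun p : PrimeSpectrum B[X] => p.asIdeal.height) := by
      intro p p' h
      exact Ideal.height_strict_mono_of_isPrime h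
    exact hm.wellFoundedLT
  have hwg : WellFoundedGT (PrimeSpectrum B[X]) := by
    have hm : StrictMono (fun p : PrimeSpectrum B[X] => p.asIdeal) := fun p p' h => h
    exact hm.wellFoundedGT
  obtain ⟨t, i, hti, hi0, hil⟩ := LTSeries.exists_relSeries_covBy s
  let d : LTSeries (PrimeSpectrum B[X]) := ⟨t.length, t.toFun, fun i => (t.step i).1⟩
  let c : LTSeries (PrimeSpectrum B[X]) := ⟨2, ![b0, q0, n0], by
    intro i
    fin_cases i
    · exact hbq.1
    · exact hqn.1⟩
  have hs0 : s.head = b0 := rfl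
  have hsl : s.last = n0 := rfl
  have hd0 : d.head = b0 := by
    rw [← hs0]
    have := congrFun hti 0
    simp only [Function.comp_apply, hi0] at this
    exact this
  have hdl : d.last = n0 := by
    rw [← hsl]
    have := congrFun hti (Fin.last _)
    simp only [Function.comp_apply, hil] at this
    exact this
  have hlen : 4 ≤ d.length + 1 := by
    have := Fintype.card_le_of_embedding i
    simpa [s, d] using this
  have := hcat c d (by rw [hd0]; rfl) (by rw [hdl]; rfl) ?_ (fun i => t.step i)
  · have hc : c.length = 2 := rfl
    omega
  · intro j
    have hc : c.length = 2 := rfl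
    obtain ⟨j, hj⟩ := j
    have : j = 0 ∨ j = 1 := by omega
    rcases this with rfl | rfl
    · exact hbq
    · exact hqn

end LICP

namespace LICP

open IsLocalRing Polynomial

/-- Saturation of `Y` with respect to `m`. -/
def sat {B : Type*} [CommRing B] (m Y : Ideal B) : Ideal B where
  carrier := {b | ∃ k : ℕ, ∀ w ∈ m ^ k, w * b ∈ Y}
  zero_mem' := ⟨0, fun w _ => by simp⟩
  add_mem' := by
    rintro a b ⟨k, hk⟩ ⟨k', hk'⟩
    refine ⟨k + k', fun w hw => ?_⟩
    rw [mul_add]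
    exact add_mem (hk w (Ideal.pow_le_pow_right (by omega) hw))
      (hk' w (Ideal.pow_le_pow_right (by omega) hw))
  smul_mem' := by
    rintro c b ⟨k, hk⟩
    refine ⟨k, fun w hw => ?_⟩
    rw [smul_eq_mul, mul_left_comm]
    exact Y.mul_mem_left _ (hk w hw)

theorem mem_sat {B : Type*} [CommRing B] {m Y : Ideal B} {b : B} :
    b ∈ sat m Y ↔ ∃ k : ℕ, ∀ w ∈ m ^ k, w * b ∈ Y := Iff.rfl

theorem le_sat {B : Type*} [CommRing B] (m Y : Ideal B) : Y ≤ sat m Y :=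
  fun b hb => ⟨0, fun w _ => Y.mul_mem_left _ hb⟩

theorem sat_mono {B : Type*} [CommRing B] (m : Ideal B) {Y Y' : Ideal B} (h : Y ≤ Y') :
    sat m Y ≤ sat m Y' := by
  rintro b ⟨k, hk⟩
  exact ⟨k, fun w hw => h (hk w hw)⟩

theorem sat_unif {B : Type*} [CommRing B] [IsNoetherianRing B] (m Y : Ideal B) :
    ∃ k : ℕ, ∀ w ∈ m ^ k, ∀ b ∈ sat m Y, w * b ∈ Y := by
  obtain ⟨s, hs⟩ := IsNoetherian.noetherian (sat m Y)
  have hm : ∀ b ∈ s, b ∈ sat m Y := fun b hb => hs ▸ Submodule.subset_span hb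
  have : ∀ b : B, ∃ k : ℕ, b ∈ s → ∀ w ∈ m ^ k, w * b ∈ Y := by
    intro b
    by_cases hb : b ∈ s
    · obtain ⟨k, hk⟩ := hm b hb
      exact ⟨k, fun _ => hk⟩
    · exact ⟨0, fun h => absurd h hb⟩
  choose k hk using this
  refine ⟨s.sup k, fun w hw b hb => ?_⟩
  rw [← hs] at hb
  refine Submodule.span_induction ?_ ?_ ?_ ?_ hb
  · intro b hb
    exact hk b hb w (Ideal.pow_le_pow_right (Finset.le_sup hb) hw)
  · simp
  · intro a b _ _ ha hb
    rw [mul_add]; exact add_mem ha hb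
  · intro c b _ hb
    rw [smul_eq_mul, mul_left_comm]; exact Y.mul_mem_left _ hb

/-- Artin-Rees consequence: a submodule killed by a power of `m` modulo `Y` misses `m ^ j`. -/
theorem ar_tors {B : Type*} [CommRing B] [IsNoetherianRing B] (m Y K : Ideal B) (k : ℕ)
    (hk : ∀ w ∈ m ^ k, ∀ b ∈ K, w * b ∈ Y) : ∃ j, ∀ b ∈ K, b ∈ m ^ j → b ∈ Y := by
  obtain ⟨c, hc⟩ := Ideal.exists_pow_inf_eq_pow_smul (R := B) (M := B ⧸ Y) m
    (Submodule.map (Submodule.mkQ Y) K)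
  refine ⟨k + c, fun b hb hbj => ?_⟩
  have h := hc (k + c) (by omega)
  have h1 : Submodule.mkQ Y b ∈ (m ^ (k + c) • ⊤ ⊓ Submodule.map (Submodule.mkQ Y) K : Submodule B (B ⧸ Y)) := by
    refine ⟨?_, Submodule.mem_map_of_mem hb⟩
    have : Submodule.mkQ Y b = b • Submodule.mkQ Y 1 := by
      rw [← map_smul, smul_eq_mul, mul_one]
    rw [this]
    exact Submodule.smul_mem_smul hbj trivial
  rw [h, Nat.add_sub_cancel] at h1
  have h2 : Submodule.mkQ Y b ∈ (m ^ k • (Submodule.map (Submodule.mkQ Y) K) : Submodule B (B ⧸ Y)) :=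
    Submodule.smul_mono le_rfl inf_le_right h1
  have h3 : (m ^ k • (Submodule.map (Submodule.mkQ Y) K) : Submodule B (B ⧸ Y)) ≤ ⊥ := by
    rw [Submodule.smul_le]
    rintro w hw _ ⟨b, hb, rfl⟩
    rw [← map_smul, Submodule.mem_bot, Submodule.mkQ_apply, Submodule.Quotient.mk_eq_zero]
    exact hk w hw b hb
  have h4 := h3 h2
  rwa [Submodule.mem_bot, Submodule.mkQ_apply, Submodule.Quotient.mk_eq_zero] at h4

/-- Artin-Rees consequence: `(Y + m ^ n : m ^ k) ⊆ (Y : m ^ k) + m ^ j` for large `n`. -/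
theorem ar_colon {B : Type*} [CommRing B] [IsNoetherianRing B] (m Y J : Ideal B) (j : ℕ) :
    ∃ n, ∀ b, (∀ w ∈ J, w * b ∈ Y ⊔ m ^ n) → ∃ b', (∀ w ∈ J, w * b' ∈ Y) ∧ b - b' ∈ m ^ j := by
  obtain ⟨s, hs⟩ := IsNoetherian.noetherian J
  let φ : B →ₗ[B] (s → B ⧸ Y) :=
    LinearMap.pi fun w => (Submodule.mkQ Y).comp (LinearMap.mulLeft B (w : B))
  obtain ⟨c, hc⟩ := Ideal.exists_pow_inf_eq_pow_smul (R := B) (M := s → B ⧸ Y) m (LinearMap.range φ)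
  refine ⟨j + c, fun b hb => ?_⟩
  have h := hc (j + c) (by omega)
  have h0 : φ b ∈ (m ^ (j + c) • ⊤ : Submodule B (s → B ⧸ Y)) := by
    classical
    have e : φ b = ∑ w, LinearMap.single B (fun _ : s => B ⧸ Y) w (φ b w) := by
      exact (Finset.univ_sum_single (φ b)).symm
    rw [e]
    refine Submodule.sum_mem _ fun w _ => ?_
    have h1 : φ b w ∈ (m ^ (j + c) • ⊤ : Submodule B (B ⧸ Y)) := by
      obtain ⟨y, hy, d, hd, hyd⟩ := Submodule.mem_sup.mp
        (hb w (hs ▸ Submodule.subset_span w.2))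
      have e2 : φ b w = d • Submodule.mkQ Y 1 := by
        change Submodule.mkQ Y ((w : B) * b) = _
        rw [← hyd, map_add, ← map_smul, smul_eq_mul, mul_one]
        have : Submodule.mkQ Y y = 0 := by
          rw [Submodule.mkQ_apply, Submodule.Quotient.mk_eq_zero]; exact hy
        rw [this, zero_add]
      rw [e2]
      exact Submodule.smul_mem_smul hd trivial
    have h2 := Submodule.mem_map_of_mem (f := LinearMap.single B (fun _ : s => B ⧸ Y) w) h1
    rw [Submodule.map_smul''] at h2
    exact Submodule.smul_mono le_rfl le_top h2
  have h1 : φ b ∈ (m ^ (j + c) • ⊤ ⊓ LinearMap.range φ : Submodule B (s → B ⧸ Y)) :=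
    ⟨h0, LinearMap.mem_range_self φ b⟩
  rw [h, Nat.add_sub_cancel] at h1
  have h2 : φ b ∈ (m ^ j • LinearMap.range φ : Submodule B (s → B ⧸ Y)) :=
    Submodule.smul_mono le_rfl inf_le_right h1
  rw [LinearMap.range_eq_map, ← Submodule.map_smul''] at h2
  obtain ⟨d, hd, hdb⟩ := h2
  refine ⟨b - d, fun w hw => ?_, by simpa using hd⟩
  have h5 : φ (b - d) = 0 := by rw [map_sub, hdb, sub_self]
  have h6 : ∀ w ∈ s, w * (b - d) ∈ Y := by
    intro w hw
    have := congrFun h5 ⟨w, hw⟩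
    change Submodule.mkQ Y (w * (b - d)) = 0 at this
    rwa [Submodule.mkQ_apply, Submodule.Quotient.mk_eq_zero] at this
  rw [← hs] at hw
  refine Submodule.span_induction h6 ?_ ?_ ?_ hw
  · simp
  · intro a b _ _ ha hb
    rw [add_mul]; exact add_mem ha hb
  · intro c b _ hb
    rw [smul_eq_mul, mul_assoc]; exact Y.mul_mem_left _ hb

/-- No prime strictly between `q` and a minimal prime of `q + (x)`. -/
theorem no_mid {S : Type*} [CommRing S] [IsNoetherianRing S] (q p n : Ideal S) [q.IsPrime]
    [p.IsPrime] (x : S) (hmin : n ∈ (q ⊔ Ideal.span {x}).minimalPrimes)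
    (hqp' : q < p) (hpn' : p < n) : False := by
  have hnp : n.IsPrime := hmin.1.1
  have h1 := Ideal.map_height_le_one_of_mem_minimalPrimes hmin
  have hk : ∀ J : Ideal S, RingHom.ker (Ideal.Quotient.mk q) ≤ J ↔ q ≤ J := by
    intro J; rw [Ideal.mk_ker]
  have hP : (p.map (Ideal.Quotient.mk q)).IsPrime :=
    Ideal.map_isPrime_of_surjective Ideal.Quotient.mk_surjective ((hk _).mpr hqp'.le)
  have hN : (n.map (Ideal.Quotient.mk q)).IsPrime :=
    Ideal.map_isPrime_of_surjective Ideal.Quotient.mk_surjective ((hk _).mpr (hqp'.trans hpn').le)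
  have hcm : ∀ J : Ideal S, q ≤ J → (J.map (Ideal.Quotient.mk q)).comap (Ideal.Quotient.mk q) = J := by
    intro J hJ
    rw [Ideal.comap_map_of_surjective _ Ideal.Quotient.mk_surjective, ← RingHom.ker_eq_comap_bot,
      Ideal.mk_ker, sup_eq_left.mpr hJ]
  have hlt : p.map (Ideal.Quotient.mk q) < n.map (Ideal.Quotient.mk q) := by
    refine lt_of_le_of_ne (Ideal.map_mono hpn'.le) fun h => hpn'.ne ?_
    rw [← hcm _ hqp'.le, h, hcm _ (hqp'.trans hpn').le]
  have hb : (⊥ : Ideal (S ⧸ q)) < p.map (Ideal.Quotient.mk q) := by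
    rw [bot_lt_iff_ne_bot]
    intro h
    apply hqp'.ne
    rw [← hcm _ hqp'.le, h, ← RingHom.ker_eq_comap_bot, Ideal.mk_ker]
  have h2 := Ideal.height_strict_mono_of_isPrime hlt
  have h3 := Ideal.height_strict_mono_of_isPrime hb
  have h4 := h2.trans_le h1
  rw [Order.lt_one_iff.mp h4] at h3
  exact absurd h3 (by simp)

end LICP

namespace LICP

open IsLocalRing Polynomial

section stab
variable {B : Type*} [CommRing B] [IsDomain B] [IsNoetherianRing B] [IsLocalRing B]

theorem mul_mem_sat {x : B} (hx0 : x ≠ 0) (m : Ideal B) (i n : ℕ) (b : B) :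
    x ^ i * b ∈ sat m (Ideal.span {x ^ (i + n)}) ↔ b ∈ sat m (Ideal.span {x ^ n}) := by
  have key : ∀ w : B, w * (x ^ i * b) ∈ Ideal.span {x ^ (i + n)} ↔ w * b ∈ Ideal.span {x ^ n} := by
    intro w
    rw [Ideal.mem_span_singleton, Ideal.mem_span_singleton, mul_left_comm, pow_add]
    exact mul_dvd_mul_iff_left (pow_ne_zero i hx0)
  simp only [mem_sat, key]

theorem stab (x : B) (hx0 : x ≠ 0) :
    ∃ n0, ∀ n ≥ n0, ∀ b ∈ sat (maximalIdeal B) (Ideal.span {x ^ n}),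
      ∃ b' ∈ sat (maximalIdeal B) (Ideal.span {x ^ (n + 1)}), x ∣ b - b' := by
  set m := maximalIdeal B
  have hanti : ∀ {a b : ℕ}, a ≤ b → sat m (Ideal.span {x ^ b}) ≤ sat m (Ideal.span {x ^ a}) := by
    intro a b hab
    apply sat_mono
    rw [Ideal.span_singleton_le_span_singleton]
    exact pow_dvd_pow x hab
  obtain ⟨k, hk⟩ := sat_unif m (Ideal.span {x ^ 1})
  obtain ⟨j, hj⟩ := ar_tors m _ _ k hk
  have hart : IsArtinianRing (B ⧸ m ^ (j + 1)) := by
    have hne : m ^ (j + 1) ≠ ⊤ := by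
      intro h
      have : m ^ (j + 1) ≤ m := Ideal.pow_le_self (by omega)
      rw [h, top_le_iff] at this
      exact (maximalIdeal.isMaximal B).ne_top this
    have : Nontrivial (B ⧸ m ^ (j + 1)) := Ideal.Quotient.nontrivial_iff.mpr hne
    have : IsLocalRing (B ⧸ m ^ (j + 1)) :=
      IsLocalRing.of_surjective' _ Ideal.Quotient.mk_surjective
    rw [isArtinianRing_iff_isNilpotent_maximalIdeal]
    refine ⟨j + 1, ?_⟩
    have : maximalIdeal (B ⧸ m ^ (j + 1)) ≤ m.map (Ideal.Quotient.mk _) := by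
      intro z hz
      obtain ⟨b, rfl⟩ := Ideal.Quotient.mk_surjective z
      refine Ideal.mem_map_of_mem _ ?_
      by_contra hb
      have hu : IsUnit b := by simpa [m] using hb
      exact hz (hu.map _)
    have h2 := Ideal.pow_right_mono this (j + 1)
    rw [← Ideal.map_pow, Ideal.map_quotient_self] at h2
    exact le_bot_iff.mp h2
  let ch : ℕ →o (Ideal (B ⧸ m ^ (j + 1)))ᵒᵈ :=
    ⟨fun n => OrderDual.toDual
      ((sat m (Ideal.span {x ^ n}) ⊔ Ideal.span {x}).map (Ideal.Quotient.mk (m ^ (j + 1)))), by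
      intro a b hab
      exact Ideal.map_mono (sup_le_sup_right (hanti hab) _)⟩
  obtain ⟨n0, hn0⟩ := IsArtinian.monotone_stabilizes ch
  refine ⟨n0 + 1, fun n hn b hb => ?_⟩
  have h1 : (sat m (Ideal.span {x ^ n}) ⊔ Ideal.span {x}).map (Ideal.Quotient.mk (m ^ (j + 1))) =
      (sat m (Ideal.span {x ^ (n + 1)}) ⊔ Ideal.span {x}).map (Ideal.Quotient.mk (m ^ (j + 1))) :=
    (hn0 n (by omega)).symm.trans (hn0 (n + 1) (by omega))
  have h2 := Ideal.mem_map_of_mem (Ideal.Quotient.mk (m ^ (j + 1)))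
    (Ideal.mem_sup_left hb : b ∈ sat m (Ideal.span {x ^ n}) ⊔ Ideal.span {x})
  rw [h1, Ideal.mem_map_iff_of_surjective _ Ideal.Quotient.mk_surjective] at h2
  obtain ⟨b', hb', he⟩ := h2
  rw [Ideal.Quotient.eq] at he
  obtain ⟨b1, hb1, b2, hb2, rfl⟩ := Submodule.mem_sup.mp hb'
  refine ⟨b1, hb1, ?_⟩
  have h3 : b1 + b2 - b ∈ sat m (Ideal.span {x ^ 1}) := by
    refine sub_mem (add_mem (hanti (by omega) hb1) ?_) (hanti (by omega) hb)
    rw [pow_one]; exact le_sat _ _ hb2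
  have h4 := hj _ h3 (Ideal.pow_le_pow_right (by omega) he)
  rw [pow_one, Ideal.mem_span_singleton] at h4
  rw [Ideal.mem_span_singleton] at hb2
  have : b - b1 = b2 - (b1 + b2 - b) := by ring
  rw [this]
  exact dvd_sub hb2 h4

theorem stab' (x : B) (hx0 : x ≠ 0) :
    ∃ n0, ∀ j, ∀ n ≥ n0, ∀ b ∈ sat (maximalIdeal B) (Ideal.span {x ^ (n + j)}),
      ∃ b' ∈ sat (maximalIdeal B) (Ideal.span {x ^ (n + j + 1)}), x ^ (j + 1) ∣ b - b' := by
  obtain ⟨n0, h⟩ := stab x hx0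
  refine ⟨n0, fun j => ?_⟩
  induction j with
  | zero => intro n hn b hb; simpa using h n hn b hb
  | succ j ih =>
    intro n hn b hb
    obtain ⟨b', hb', d, hd⟩ := ih (n + 1) (by omega) b (by convert hb using 4; ring)
    have h1 : x ^ (j + 1) * d ∈ sat (maximalIdeal B) (Ideal.span {x ^ ((j + 1) + n)}) := by
      rw [← hd]
      refine sub_mem (by convert hb using 4; ring) ?_
      refine sat_mono _ ?_ hb'
      rw [Ideal.span_singleton_le_span_singleton]
      exact pow_dvd_pow x (by omega)
    rw [mul_mem_sat hx0] at h1
    obtain ⟨e, he, e', he'⟩ := h n hn d h1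
    refine ⟨b' + x ^ (j + 1) * e, add_mem (by convert hb' using 4; ring) ?_, e', ?_⟩
    · rw [← mul_mem_sat hx0 _ (j + 1)] at he
      convert he using 4; ring
    · linear_combination hd + x ^ (j + 1) * he'

theorem exists_V {C : Type*} [CommRing C] {f : B →+* C} (h : CL f) (x : B) (hx0 : x ≠ 0)
    (hxm : x ∈ maximalIdeal B)
    (hK : ∀ n, ¬ sat (maximalIdeal B) (Ideal.span {x ^ n}) ≤ Ideal.span {x}) :
    ∃ c : C, c ≠ 0 ∧ ∀ n, c ∈ sat ((maximalIdeal B).map f) (Ideal.span {f x ^ n}) := by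
  have := h.noeth
  have := h.loc
  set m := maximalIdeal B
  obtain ⟨n0, hn0⟩ := stab' x hx0
  obtain ⟨b0, hb0, hb0x⟩ := Set.not_subset.mp (hK n0)
  let T := fun j : ℕ => {b : B // b ∈ sat m (Ideal.span {x ^ (n0 + j)})}
  choose nx hnx hnx' using fun j => hn0 j n0 le_rfl
  let κ : ∀ j, T j := fun j => Nat.rec (motive := T) ⟨b0, hb0⟩ (fun j b => ⟨nx j b.1 b.2, hnx j b.1 b.2⟩) j
  have hκ : ∀ j, x ^ (j + 1) ∣ (κ j).1 - (κ (j + 1)).1 := fun j => hnx' j (κ j).1 (κ j).2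
  have hκ' : ∀ j i, x ^ (j + 1) ∣ (κ j).1 - (κ (j + i)).1 := by
    intro j i
    induction i with
    | zero => simp
    | succ i ih =>
      have h1 := (pow_dvd_pow x (show j + 1 ≤ j + i + 1 by omega)).trans (hκ (j + i))
      have := dvd_add ih h1
      rw [sub_add_sub_cancel] at this
      exact this
  have hxp : ∀ j b, x ^ (j + 1) ∣ b → b ∈ m ^ j := by
    intro j b hb
    exact Ideal.mem_of_dvd _ ((pow_dvd_pow x (Nat.le_succ j)).trans hb) (Ideal.pow_mem_pow hxm j)
  obtain ⟨c, hc⟩ := h.lim (fun j => (κ j).1) (fun j => by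
    rw [← neg_sub]; exact neg_mem (hxp _ _ (hκ j)))
  have hcx : ∀ j, f x ^ (j + 1) ∣ c - f (κ j).1 := by
    intro j
    rw [← Ideal.mem_span_singleton]
    refine closed_ideal _ (m.map f) h.le_max _ fun i => ?_
    have h1 := Ideal.pow_le_pow_right (show i ≤ j + i by omega) (hc (j + i))
    have h2 : f (κ j).1 - f (κ (j + i)).1 ∈ Ideal.span {f x ^ (j + 1)} := by
      rw [Ideal.mem_span_singleton, ← map_sub, ← map_pow]
      exact map_dvd f (hκ' j i)
    have := sub_mem (Ideal.mem_sup_right h1 : _ ∈ Ideal.span {f x ^ (j + 1)} ⊔ m.map f ^ i)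
      (Ideal.mem_sup_left h2)
    convert this using 1; ring
  refine ⟨c, ?_, ?_⟩
  · rintro rfl
    apply hb0x
    apply h.contr
    have := hcx 0
    rw [Ideal.map_span, Set.image_singleton, Ideal.mem_span_singleton]
    simpa [κ] using this
  · intro n
    have h1 : f (κ n).1 ∈ sat (m.map f) (Ideal.span {f x ^ n}) := by
      obtain ⟨k, hk⟩ := (κ n).2
      refine ⟨k, fun w hw => ?_⟩
      rw [← Ideal.map_pow] at hw
      have h3 : ∀ w ∈ (m ^ k).map f, w * f (κ n).1 ∈ Ideal.span {f x ^ n} := by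
        intro w hw
        refine Submodule.span_induction ?_ ?_ ?_ ?_ hw
        · rintro _ ⟨w, hw, rfl⟩
          rw [← map_mul, Ideal.mem_span_singleton, ← map_pow]
          have := hk w hw
          rw [Ideal.mem_span_singleton] at this
          exact map_dvd f ((pow_dvd_pow x (by omega)).trans this)
        · simp
        · intro a b _ _ ha hb
          rw [add_mul]; exact add_mem ha hb
        · intro c b _ hb
          rw [smul_eq_mul, mul_assoc]; exact Ideal.mul_mem_left _ _ hb
      exact h3 w hw
    have h2 : c - f (κ n).1 ∈ sat (m.map f) (Ideal.span {f x ^ n}) := by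
      apply le_sat
      rw [Ideal.mem_span_singleton]
      exact (pow_dvd_pow _ (Nat.le_succ n)).trans (hcx n)
    simpa using add_mem h2 h1

end stab

end LICP

namespace LICP

open IsLocalRing Polynomial

/-- Existence of an associated prime `Q = ann g` with small dimension. -/
theorem exists_Q {C : Type*} [CommRing C] [IsNoetherianRing C] [IsLocalRing C] (X : C)
    (hX : X ∈ maximalIdeal C) (c : C)
    (hc0 : c ≠ 0) (hc : ∀ n, c ∈ sat (maximalIdeal C) (Ideal.span {X ^ n})) :
    ∃ (g : C) (Q : Ideal C), Q.IsPrime ∧ g ≠ 0 ∧ (∀ r, r * g = 0 ↔ r ∈ Q) ∧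
      ∀ t, t ∉ Q → ∃ k, maximalIdeal C ^ k ≤ Q ⊔ Ideal.span {t} := by
  let V : Submodule C C := ⨅ n, sat (maximalIdeal C) (Ideal.span {X ^ n})
  have hcV : c ∈ V := by rw [Submodule.mem_iInf]; exact hc
  obtain ⟨Q, hQ, -⟩ := exists_le_isAssociatedPrime_of_isNoetherianRing C (⟨c, hcV⟩ : V)
    (by simpa using hc0)
  rw [isAssociatedPrime_iff] at hQ
  obtain ⟨hQp, ⟨g, hgV⟩, hg⟩ := hQ
  have hgQ : ∀ r, r * g = 0 ↔ r ∈ Q := by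
    intro r
    rw [hg, Submodule.mem_colon_singleton]
    simp [Subtype.ext_iff]
  have hg0 : g ≠ 0 := by
    rintro rfl
    exact hQp.ne_top ((Ideal.eq_top_iff_one _).mpr ((hgQ 1).mp (by simp)))
  rw [Submodule.mem_iInf] at hgV
  have hQm : Q ≤ maximalIdeal C := le_maximalIdeal hQp.ne_top
  have claimA : ∀ q : Ideal C, q.IsPrime → Q ≤ q → X ∈ q → q = maximalIdeal C := by
    intro q hq hQq hXq
    by_contra hne
    have hle : q ≤ maximalIdeal C := le_maximalIdeal hq.ne_top
    obtain ⟨w, hw, hwq⟩ := Set.not_subset.mp (fun h => hne (le_antisymm hle h))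
    let S := Localization.AtPrime q
    have h1 : algebraMap C S g = 0 := by
      have key := Ideal.iInf_pow_smul_eq_bot_of_isLocalRing (R := S) (M := S) (maximalIdeal S)
        (maximalIdeal.isMaximal S).ne_top
      have : algebraMap C S g ∈ (⨅ i : ℕ, maximalIdeal S ^ i • (⊤ : Submodule S S)) := by
        rw [Submodule.mem_iInf]
        intro n
        obtain ⟨k, hk⟩ := hgV n
        obtain ⟨d, hd⟩ := Ideal.mem_span_singleton.mp (hk (w ^ k) (Ideal.pow_mem_pow hw k))
        have hu : IsUnit (algebraMap C S (w ^ k)) :=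
          IsLocalization.map_units S (⟨w ^ k, fun h => hwq (hq.mem_of_pow_mem _ h)⟩ : q.primeCompl)
        have h2 : algebraMap C S (w ^ k) * algebraMap C S g ∈ maximalIdeal S ^ n := by
          rw [← map_mul, hd, map_mul, map_pow]
          refine Ideal.mul_mem_right _ _ (Ideal.pow_mem_pow ?_ n)
          rw [← Localization.AtPrime.map_eq_maximalIdeal]
          exact Ideal.mem_map_of_mem _ hXq
        rw [smul_eq_mul, Ideal.mul_top]
        exact (Ideal.unit_mul_mem_iff_mem _ hu).mp h2
      rw [key] at this
      simpa using this
    rw [IsLocalization.map_eq_zero_iff q.primeCompl] at h1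
    obtain ⟨s, hs⟩ := h1
    exact s.2 (hQq ((hgQ _).mp hs))
  have hmin : maximalIdeal C ∈ (Q ⊔ Ideal.span {X}).minimalPrimes := by
    refine ⟨⟨inferInstance, sup_le hQm ((Ideal.span_singleton_le_iff_mem _).mpr hX)⟩, ?_⟩
    rintro p ⟨hp, hle⟩ -
    rw [claimA p hp (le_sup_left.trans hle)
      (hle (Ideal.mem_sup_right (Ideal.mem_span_singleton_self X)))]
  refine ⟨g, Q, hQp, hg0, hgQ, fun t ht => ?_⟩
  refine Ideal.exists_pow_le_of_le_radical_of_fg ?_ (IsNoetherian.noetherian _)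
  rw [Ideal.radical_eq_sInf]
  refine le_sInf ?_
  rintro p ⟨hle, hp⟩
  have hQp' : Q < p := by
    refine lt_of_le_of_ne (le_sup_left.trans hle) ?_
    rintro rfl
    exact ht (hle (Ideal.mem_sup_right (Ideal.mem_span_singleton_self t)))
  by_contra hn
  have hpm : p < maximalIdeal C :=
    lt_of_le_of_ne (le_maximalIdeal hp.ne_top) (fun h => hn h.ge)
  exact no_mid Q p _ X hmin hQp' hpm

set_option maxHeartbeats 1000000 in
theorem DL {B : Type*} [CommRing B] [IsDomain B] [IsNoetherianRing B] [IsLocalRing B]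
    {C : Type*} [CommRing C] {f : B →+* C} (h : CL f) (hred : IsReduced C) (x : B) (hx0 : x ≠ 0)
    (hxm : x ∈ maximalIdeal B)
    (hbad : ∀ y a l q, ¬ BadData B y a l q) :
    ∃ n, sat (maximalIdeal B) (Ideal.span {x ^ n}) ≤ Ideal.span {x} := by
  by_contra hK
  push Not at hK
  have := h.noeth
  have := h.loc
  obtain ⟨c, hc0, hc⟩ := exists_V h x hx0 hxm hK
  have hM := h.max_eq
  rw [hM] at hc
  set m := maximalIdeal B
  set M := maximalIdeal C
  have hfm : ∀ j, ∀ b ∈ m ^ j, f b ∈ M ^ j := by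
    intro j b hb
    rw [← hM, ← Ideal.map_pow]; exact Ideal.mem_map_of_mem f hb
  have hfM : ∀ b, f b ∈ M → b ∈ m := by
    intro b hb
    by_contra hn
    have hu : IsUnit b := by simpa [m] using hn
    exact hb (hu.map f)
  obtain ⟨g, Q, hQ, hg0, hgQ, hpow⟩ :=
    exists_Q (f x) (by rw [← pow_one (maximalIdeal C)]; exact hfm 1 x (by rwa [pow_one])) c hc0 hc
  have hgg : g ∉ Q := by
    rw [← hgQ]
    intro hgg
    exact hg0 (hred.eq_zero g ⟨2, by rw [pow_two]; exact hgg⟩)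
  have hnzd : ∀ b : B, f b ∈ Q → b = 0 := by
    intro b hb
    by_contra hb0
    rw [← hgQ] at hb
    exact hg0 (h.nzd b (fun d hd => (mul_eq_zero.mp hd).resolve_left hb0) g hb)
  obtain ⟨k, hk⟩ := hpow g hgg
  -- the element y
  obtain ⟨y, hy0, hym, hyk⟩ : ∃ y : B, y ≠ 0 ∧ y ∈ m ∧ f y ∈ M ^ k :=
    ⟨x ^ (k + 1), pow_ne_zero _ hx0, Ideal.pow_mem_of_mem _ hxm _ (by omega),
      hfm k _ (Ideal.pow_le_pow_right (by omega) (Ideal.pow_mem_pow hxm (k + 1)))⟩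
  obtain ⟨k', hk'⟩ := hpow (f y) (fun hq => hy0 (hnzd y hq))
  obtain ⟨v, hv, u, hu, hvu⟩ := Submodule.mem_sup.mp (hk hyk)
  obtain ⟨c', rfl⟩ := Ideal.mem_span_singleton'.mp hu
  have hQg : ∀ r ∈ Q, r * g = 0 := fun r hr => (hgQ r).mpr hr
  obtain ⟨u, hu'⟩ : ∃ u, u = c' * g := ⟨_, rfl⟩
  rw [← hu'] at hvu hu
  have hvg := hQg v hv
  have hvu0 : u * v = 0 := by rw [hu']; linear_combination c' * hvg
  have huu : u * u = f y * u := by rw [← hvu]; linear_combination -hvu0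
  -- M^k u ⊆ y C
  have hku : M ^ k * Ideal.span {u} ≤ Ideal.span {f y} := by
    rw [Ideal.mul_le]
    intro w hw r hr
    obtain ⟨d, rfl⟩ := Ideal.mem_span_singleton'.mp hr
    obtain ⟨v', hv', e', he', rfl⟩ := Submodule.mem_sup.mp (hk hw)
    obtain ⟨e, rfl⟩ := Ideal.mem_span_singleton'.mp he'
    rw [Ideal.mem_span_singleton]
    refine ⟨g * e * d, ?_⟩
    rw [← hvu, hu']
    linear_combination d * c' * hQg v' hv' - e * d * hvg
  have hQu : ∀ r ∈ Q, r * u = 0 := by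
    intro r hr; rw [hu']; linear_combination c' * hQg r hr
  -- M^(k1+k) u ⊆ y^2 C
  have hlu : M ^ (k' + k) * Ideal.span {u} ≤ Ideal.span {f y} * Ideal.span {f y} := by
    rw [pow_add, mul_assoc, Ideal.mul_le]
    intro w hw r hr
    have hr2 : r ∈ Ideal.span {u} :=
      (Ideal.mul_le_right : M ^ k * Ideal.span {u} ≤ Ideal.span {u}) hr
    obtain ⟨e, rfl⟩ := Ideal.mem_span_singleton.mp (hku hr)
    obtain ⟨d, hd⟩ := Ideal.mem_span_singleton'.mp hr2
    obtain ⟨v', hv', e', he', rfl⟩ := Submodule.mem_sup.mp (hk' hw)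
    obtain ⟨e2, rfl⟩ := Ideal.mem_span_singleton'.mp he'
    have : (v' + e2 * f y) * (f y * e) = (f y) * (f y * e * e2) := by
      linear_combination d * hQu v' hv' - v' * hd
    rw [this]
    exact Ideal.mul_mem_mul (Ideal.mem_span_singleton_self _)
      (Ideal.mul_mem_right _ _ (Ideal.mul_mem_right _ _ (Ideal.mem_span_singleton_self _)))
  -- find a
  let U : Ideal C :=
    { carrier := {z | ∀ w ∈ M ^ k, w * z ∈ Ideal.span {f y}}
      zero_mem' := by intro w _; simp
      add_mem' := by intro a b ha hb w hw; rw [mul_add]; exact add_mem (ha w hw) (hb w hw)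
      smul_mem' := by
        intro c b hb w hw
        rw [smul_eq_mul, mul_left_comm]; exact Ideal.mul_mem_left _ _ (hb w hw) }
  have huU : u ∈ U := fun w hw => hku (Ideal.mul_mem_mul hw (Ideal.mem_span_singleton_self u))
  obtain ⟨j, hj⟩ := ar_tors M (Ideal.span {f y}) U k (fun w hw b hb => hb w hw)
  obtain ⟨n, hn⟩ := ar_colon m (Ideal.span {y}) (m ^ k) j
  obtain ⟨b, hb⟩ := h.dense (n + j) u
  have hmapy : (Ideal.span {y}).map f = Ideal.span {f y} := by
    rw [Ideal.map_span, Set.image_singleton]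
  obtain ⟨a0, ha0, hba⟩ := hn b (fun w hw => by
    apply h.contr
    rw [Ideal.map_sup, Ideal.map_pow, hM, hmapy, map_mul]
    have h1 := huU (f w) (hfm k w hw)
    rw [hM] at hb
    have h2 := Ideal.mul_mem_left _ (f w) (Ideal.pow_le_pow_right (show n ≤ n + j by omega) hb)
    have := sub_mem (Ideal.mem_sup_left h1 : _ ∈ Ideal.span {f y} ⊔ M ^ n) (Ideal.mem_sup_right h2)
    convert this using 1; ring)
  have ha0u : u - f a0 ∈ Ideal.span {f y} := by
    apply hj
    · refine sub_mem huU ?_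
      intro w hw
      rw [← hM, ← Ideal.map_pow] at hw
      refine Submodule.span_induction ?_ ?_ ?_ ?_ hw
      · rintro _ ⟨w, hw, rfl⟩
        rw [← map_mul, ← hmapy]
        exact Ideal.mem_map_of_mem f (ha0 w hw)
      · simp
      · intro a b _ _ ha hb
        rw [add_mul]; exact add_mem ha hb
      · intro c b _ hb
        rw [smul_eq_mul, mul_assoc]; exact Ideal.mul_mem_left _ _ hb
    · rw [hM] at hb
      have := add_mem (Ideal.pow_le_pow_right (show j ≤ n + j by omega) hb) (hfm j _ hba)
      rw [map_sub] at this
      convert this using 1; ring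
  obtain ⟨c0, hc0'⟩ := Ideal.mem_span_singleton.mp ha0u
  set l := k' + k with hl
  obtain ⟨b0, hb0⟩ := h.dense (l + 1) c0
  rw [hM] at hb0
  obtain ⟨c1, hc1⟩ : ∃ c1, c1 = -(c0 - f b0) := ⟨_, rfl⟩
  have hc1M : c1 ∈ M ^ (l + 1) := by rw [hc1]; exact neg_mem hb0
  obtain ⟨a, ha⟩ : ∃ a, a = a0 + y * b0 := ⟨_, rfl⟩
  have hfa : f a = u + f y * c1 := by
    rw [ha, hc1, map_add, map_mul]
    linear_combination -hc0'
  have hc1M' : c1 ∈ M := Ideal.pow_le_self (by omega) hc1M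
  let ev : B[X] →+* C := eval₂RingHom f (1 + c1)
  refine hbad y a l (Q.comap ev) ⟨hy0, hym, ?_, ?_, Ideal.comap_isPrime _ _, ?_, ?_, ?_⟩
  · intro w hw
    have h1 : w * a ∈ Ideal.span {y} * (Ideal.span {y} ⊔ m ^ (l + 1)) := by
      apply h.contr
      rw [Ideal.map_mul, Ideal.map_sup, hmapy, Ideal.map_pow, hM, Ideal.mul_sup, map_mul, hfa, mul_add]
      refine add_mem (Ideal.mem_sup_left ?_) (Ideal.mem_sup_right ?_)
      · exact hlu (Ideal.mul_mem_mul (hfm _ _ hw) (Ideal.mem_span_singleton_self u))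
      · rw [mul_left_comm]
        exact Ideal.mul_mem_mul (Ideal.mem_span_singleton_self _) (Ideal.mul_mem_left _ _ hc1M)
    obtain ⟨b', hb', he⟩ := Ideal.mem_span_singleton_mul.mp h1
    exact ⟨b', he.symm, hb'⟩
  · have h1 : a ^ 2 - y * a ∈ Ideal.span {y ^ 2} * m := by
      apply h.contr
      rw [Ideal.map_mul, Ideal.map_span, Set.image_singleton, hM]
      have h2 : c1 * u ∈ Ideal.span {f y} * M := by
        have h3 : M ^ (k + 1) * Ideal.span {u} ≤ Ideal.span {f y} * M := by
          rw [pow_succ', mul_assoc, mul_comm]; exact Ideal.mul_mono hku le_rfl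
        exact h3 (Ideal.mul_mem_mul (Ideal.pow_le_pow_right (by omega) hc1M)
          (Ideal.mem_span_singleton_self u))
      obtain ⟨d, hd, hdu⟩ := Ideal.mem_span_singleton_mul.mp h2
      have : f (a ^ 2 - y * a) = f (y ^ 2) * (2 * d + c1 * c1 - c1) := by
        simp only [map_sub, map_mul, map_pow, hfa]
        linear_combination huu - 2 * f y * hdu
      rw [this]
      exact Ideal.mul_mem_mul (Ideal.mem_span_singleton_self _)
        (sub_mem (add_mem (Ideal.mul_mem_left _ _ hd) (Ideal.mul_mem_left _ _ hc1M')) hc1M')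
    obtain ⟨b', hb', he⟩ := Ideal.mem_span_singleton_mul.mp h1
    exact ⟨b', hb', he.symm⟩
  · intro b hb
    apply hnzd
    simpa [ev, Ideal.mem_comap] using hb
  · rw [Ideal.mem_comap]
    have : ev (Polynomial.C y * X - Polynomial.C a) = v := by
      simp only [ev, coe_eval₂RingHom, eval₂_sub, eval₂_mul, eval₂_C, eval₂_X, hfa]
      linear_combination -hvu
    rw [this]; exact hv
  · intro φ hφ
    rw [Ideal.mem_comap] at hφ
    apply hfM
    obtain ⟨ψ, hψ⟩ := X_sub_C_dvd_sub_C_eval (a := (1 : B)) (p := φ)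
    have h1 := congrArg ev hψ
    rw [map_sub, map_mul] at h1
    have h2 : ev (Polynomial.C (φ.eval 1)) = f (φ.eval 1) := by simp [ev]
    have h3 : ev (X - Polynomial.C 1) = c1 := by simp [ev]
    rw [h2, h3] at h1
    have h4 : f (φ.eval 1) = ev φ - c1 * ev ψ := by rw [← h1]; ring
    rw [h4]
    exact sub_mem (le_maximalIdeal hQ.ne_top hφ) (Ideal.mul_mem_right _ _ hc1M')

end LICP

namespace LICP

open IsLocalRing

theorem iter_sat {B : Type*} [CommRing B] [IsDomain B] (m : Ideal B) (x : B) (hx0 : x ≠ 0) (c : ℕ)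
    (hc : sat m (Ideal.span {x ^ c}) ≤ Ideal.span {x}) (n : ℕ) :
    sat m (Ideal.span {x ^ n}) ≤ Ideal.span {x ^ (n - c)} := by
  have key : ∀ i, sat m (Ideal.span {x ^ (c + i)}) ≤ Ideal.span {x ^ i} := by
    intro i
    induction i with
    | zero => simp
    | succ i ih =>
      intro b hb
      have h1 : b ∈ sat m (Ideal.span {x ^ c}) := by
        refine sat_mono m ?_ hb
        rw [Ideal.span_singleton_le_span_singleton]
        exact pow_dvd_pow x (by omega)
      obtain ⟨b', rfl⟩ := Ideal.mem_span_singleton.mp (hc h1)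
      have h2 : b' ∈ sat m (Ideal.span {x ^ (c + i)}) := by
        obtain ⟨k, hk⟩ := hb
        refine ⟨k, fun w hw => ?_⟩
        have := hk w hw
        rw [Ideal.mem_span_singleton] at this ⊢
        rw [mul_left_comm, ← add_assoc, pow_succ'] at this
        exact (mul_dvd_mul_iff_left hx0).mp this
      obtain ⟨d, rfl⟩ := Ideal.mem_span_singleton.mp (ih h2)
      rw [Ideal.mem_span_singleton]
      exact ⟨d, by ring⟩
  rcases le_total n c with h | h
  · rw [Nat.sub_eq_zero_of_le h]; simp
  · obtain ⟨i, rfl⟩ := Nat.exists_eq_add_of_le h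
    rw [Nat.add_sub_cancel_left]; exact key i

/-- The uniform saturation property for a module. -/
def GP {A : Type*} [CommRing A] (m : Ideal A) (x : A) (N : Type*) [AddCommGroup N] [Module A N] :
    Prop :=
  ∃ c : ℕ, ∀ (n : ℕ) (v : N), (∃ k : ℕ, ∀ w ∈ m ^ k, ∃ u : N, w • v = x ^ n • u) →
    ∃ u : N, v = x ^ (n - c) • u

section
variable {A : Type*} [CommRing A] (m : Ideal A) (x : A)

theorem GP.ext {N N2 : Type*} [AddCommGroup N] [Module A N] [AddCommGroup N2] [Module A N2]
    (h : N →ₗ[A] N2) (hx : ∀ v : N2, x • v = 0 → v = 0) (hk : GP m x (LinearMap.ker h))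
    (hr : GP m x (LinearMap.range h)) : GP m x N := by
  obtain ⟨c1, h1⟩ := hr
  obtain ⟨c2, h2⟩ := hk
  have hxn : ∀ (n : ℕ) (v : N2), x ^ n • v = 0 → v = 0 := by
    intro n
    induction n with
    | zero => intro v hv; simpa using hv
    | succ n ih =>
      intro v hv
      rw [pow_succ, mul_smul] at hv
      exact hx _ (ih _ hv)
  refine ⟨c1 + c2, fun n v ⟨k, hk⟩ => ?_⟩
  obtain ⟨⟨_, u1, rfl⟩, hu1⟩ := h1 n ⟨h v, LinearMap.mem_range_self h v⟩ ⟨k, fun w hw => by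
    obtain ⟨u, hu⟩ := hk w hw
    refine ⟨⟨h u, LinearMap.mem_range_self h u⟩, ?_⟩
    ext
    simp only [Submodule.coe_smul]
    rw [← map_smul, ← map_smul, hu]⟩
  have hu1' : h v = x ^ (n - c1) • h u1 := by simpa [Subtype.ext_iff] using hu1
  have hker : v - x ^ (n - c1) • u1 ∈ LinearMap.ker h := by
    rw [LinearMap.mem_ker, map_sub, map_smul, hu1', sub_self]
  obtain ⟨⟨u2, hu2⟩, he⟩ := h2 (n - c1) ⟨_, hker⟩ ⟨k, fun w hw => by
    obtain ⟨u, hu⟩ := hk w hw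
    have e : w • (v - x ^ (n - c1) • u1) = x ^ (n - c1) • (x ^ (n - (n - c1)) • u - w • u1) := by
      have hp : x ^ n = x ^ (n - c1) * x ^ (n - (n - c1)) := by
        rw [← pow_add]; congr 1; omega
      rw [smul_sub, smul_sub, hu, hp, mul_smul, smul_comm w]
    refine ⟨⟨x ^ (n - (n - c1)) • u - w • u1, ?_⟩, ?_⟩
    · rw [LinearMap.mem_ker]
      apply hxn (n - c1)
      rw [← map_smul, ← e, map_smul, LinearMap.mem_ker.mp hker, smul_zero]
    · ext; exact e⟩
  have he' : v - x ^ (n - c1) • u1 = x ^ (n - c1 - c2) • u2 := by simpa [Subtype.ext_iff] using he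
  refine ⟨u2 + x ^ (n - c1 - (n - (c1 + c2))) • u1, ?_⟩
  rw [smul_add, smul_smul, ← pow_add, ← Nat.sub_sub, ← he']
  rw [show n - c1 - c2 + (n - c1 - (n - c1 - c2)) = n - c1 by omega]
  simp

theorem GP.sub [IsNoetherianRing A] {N N1 : Type*} [AddCommGroup N] [Module A N]
    [AddCommGroup N1] [Module A N1] [Module.Finite A N1] (f : N →ₗ[A] N1)
    (hf : Function.Injective f) (h : GP m x N1) : GP m x N := by
  obtain ⟨c, hc⟩ := h
  obtain ⟨k0, hk0⟩ := Ideal.exists_pow_inf_eq_pow_smul (R := A) (M := N1) (Ideal.span {x})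
    (LinearMap.range f)
  refine ⟨c + k0, fun n v ⟨k, hk⟩ => ?_⟩
  obtain ⟨u1, hu1⟩ := hc n (f v) ⟨k, fun w hw => by
    obtain ⟨u, hu⟩ := hk w hw
    exact ⟨f u, by rw [← map_smul, hu, map_smul]⟩⟩
  rcases le_total k0 (n - c) with hle | hle
  · have h1 := hk0 (n - c) hle
    have h2 : f v ∈ (Ideal.span {x} ^ (n - c) • ⊤ ⊓ LinearMap.range f : Submodule A N1) := by
      refine ⟨?_, LinearMap.mem_range_self f v⟩
      rw [hu1]
      exact Submodule.smul_mem_smul (Ideal.pow_mem_pow (Ideal.mem_span_singleton_self x) _) trivial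
    rw [h1] at h2
    have h3 : f v ∈ (Ideal.span {x} ^ (n - c - k0) • LinearMap.range f : Submodule A N1) :=
      Submodule.smul_mono le_rfl inf_le_right h2
    rw [Ideal.span_singleton_pow, Submodule.ideal_span_singleton_smul,
      Submodule.mem_smul_pointwise_iff_exists] at h3
    obtain ⟨_, ⟨u, rfl⟩, hu⟩ := h3
    refine ⟨u, hf ?_⟩
    rw [map_smul, ← Nat.sub_sub, hu]
  · refine ⟨v, ?_⟩
    rw [← Nat.sub_sub, Nat.sub_eq_zero_of_le hle]; simp

/-- `GP` for `A ⧸ P`, in elementary terms. -/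
def GQ (P : Ideal A) : Prop :=
  ∃ c : ℕ, ∀ (n : ℕ) (r : A), (∃ k : ℕ, ∀ w ∈ m ^ k, ∃ s, w * r - x ^ n * s ∈ P) →
    ∃ s, r - x ^ (n - c) * s ∈ P

theorem GQ.cyclic {P : Ideal A} (h : GQ m x P) {N : Type*} [AddCommGroup N] [Module A N] (e : N)
    (he : ∀ r : A, r • e = 0 ↔ r ∈ P) : GP m x (Submodule.span A {e}) := by
  obtain ⟨c, hc⟩ := h
  have key : ∀ r s : A, r • e = s • e ↔ r - s ∈ P := by
    intro r s
    rw [← he, sub_smul, sub_eq_zero]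
  refine ⟨c, ?_⟩
  rintro n ⟨v, hv⟩ ⟨k, hk⟩
  obtain ⟨r, rfl⟩ := Submodule.mem_span_singleton.mp hv
  obtain ⟨s, hs⟩ := hc n r ⟨k, fun w hw => by
    obtain ⟨⟨u, hu⟩, hu2⟩ := hk w hw
    obtain ⟨s, rfl⟩ := Submodule.mem_span_singleton.mp hu
    refine ⟨s, ?_⟩
    rw [← key, mul_smul, mul_smul]
    simpa [Subtype.ext_iff] using hu2⟩
  refine ⟨⟨s • e, Submodule.smul_mem _ _ (Submodule.mem_span_singleton_self e)⟩, ?_⟩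
  ext
  simp only [Submodule.coe_smul]
  rw [← mul_smul, key]; exact hs

theorem GP.ring [IsNoetherianRing A] (hemb : LIC.HasNoEmbeddedPrimes A)
    (hx : x ∈ nonZeroDivisors A) (hP : ∀ P ∈ minimalPrimes A, GQ m x P) :
    ∃ c : ℕ, ∀ n, sat m (Ideal.span {x ^ n}) ≤ Ideal.span {x ^ (n - c)} := by
  let S : Set (Ideal A) := {U | (∀ w ∈ nonZeroDivisors A, ∀ a, w * a ∈ U → a ∈ U) ∧ GP m x U}
  have hS : S.Nonempty := by
    refine ⟨⊥, ?_, 0, fun n v _ => ⟨0, ?_⟩⟩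
    · intro w hw a ha
      rw [Ideal.mem_bot] at ha ⊢
      exact (mem_nonZeroDivisors_iff.mp hw).1 a ha
    · rw [smul_zero]; exact Subsingleton.elim _ _
  obtain ⟨U, ⟨hU1, hU2⟩, hmax⟩ := WellFounded.has_min (wellFounded_gt (α := Ideal A)) S hS
  have htop : U = ⊤ := by
    by_contra hne
    have h1 : (Submodule.mkQ U 1) ≠ 0 := by
      rw [Ne, Submodule.mkQ_apply, Submodule.Quotient.mk_eq_zero]
      exact fun h => hne ((Ideal.eq_top_iff_one U).mpr h)
    obtain ⟨P, hPa, -⟩ := exists_le_isAssociatedPrime_of_isNoetherianRing A (Submodule.mkQ U 1) h1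
    rw [isAssociatedPrime_iff] at hPa
    obtain ⟨hPp, e, hPe⟩ := hPa
    obtain ⟨v, rfl⟩ := Submodule.mkQ_surjective U e
    have hPv : ∀ r : A, r • Submodule.mkQ U v = 0 ↔ r ∈ P := by
      intro r
      rw [hPe, Submodule.mem_colon_singleton]; rfl
    have hPv' : ∀ r : A, r * v ∈ U ↔ r ∈ P := by
      intro r
      rw [← hPv, ← map_smul, Submodule.mkQ_apply, Submodule.Quotient.mk_eq_zero, smul_eq_mul]
    have hvU : v ∉ U := by
      intro h
      exact hPp.ne_top ((Ideal.eq_top_iff_one P).mpr ((hPv' 1).mp (by simpa using h)))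
    have hPW : ∀ w ∈ P, w ∉ nonZeroDivisors A := by
      intro w hw hw'
      exact hvU (hU1 w hw' v ((hPv' w).mpr hw))
    have hPmin : P ∈ minimalPrimes A := by
      have hsub : (P : Set A) ⊆ ⋃ p ∈ associatedPrimes A A, (p : Set A) := by
        rw [biUnion_associatedPrimes_eq_compl_nonZeroDivisors]
        exact fun w hw => hPW w hw
      rw [Ideal.subset_union_prime_finite (associatedPrimes.finite A A) (f := fun p => p) ⊥ ⊥
        (fun p hp _ _ => hp.isPrime)] at hsub
      obtain ⟨q, hq, hPq⟩ := hsub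
      have hqm := hemb q hq
      have : q = P := le_antisymm (hqm.2 ⟨hPp, bot_le⟩ hPq) hPq
      rwa [← this]
    let U' : Ideal A :=
      { carrier := {u | ∃ w ∈ nonZeroDivisors A, w * u ∈ U ⊔ Ideal.span {v}}
        zero_mem' := ⟨1, one_mem _, by simp⟩
        add_mem' := by
          rintro a b ⟨w, hw, ha⟩ ⟨w', hw', hb⟩
          refine ⟨w * w', mul_mem hw hw', ?_⟩
          have := add_mem (Ideal.mul_mem_left _ w' ha) (Ideal.mul_mem_left _ w hb)
          convert this using 1; ring
        smul_mem' := by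
          rintro c a ⟨w, hw, ha⟩
          refine ⟨w, hw, ?_⟩
          rw [smul_eq_mul, mul_left_comm]; exact Ideal.mul_mem_left _ _ ha }
    obtain ⟨w0, hw0, hw0U⟩ : ∃ w0 ∈ nonZeroDivisors A, ∀ u ∈ U', w0 * u ∈ U ⊔ Ideal.span {v} := by
      obtain ⟨s, hs⟩ := IsNoetherian.noetherian U'
      have : ∀ b : A, ∃ w ∈ nonZeroDivisors A, b ∈ s → w * b ∈ U ⊔ Ideal.span {v} := by
        intro b
        by_cases hb : b ∈ s
        · obtain ⟨w, hw, h⟩ : b ∈ U' := hs ▸ Submodule.subset_span hb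
          exact ⟨w, hw, fun _ => h⟩
        · exact ⟨1, one_mem _, fun h => absurd h hb⟩
      choose w hw hwb using this
      refine ⟨∏ b ∈ s, w b, prod_mem fun b _ => hw b, fun u hu => ?_⟩
      rw [← hs] at hu
      refine Submodule.span_induction ?_ ?_ ?_ ?_ hu
      · intro b hb
        obtain ⟨d, hd⟩ := Finset.dvd_prod_of_mem w hb
        rw [hd, mul_comm (w b), mul_assoc]
        exact Ideal.mul_mem_left _ _ (hwb b hb)
      · simp
      · intro a b _ _ ha hb
        rw [mul_add]; exact add_mem ha hb
      · intro c b _ hb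
        rw [smul_eq_mul, mul_left_comm]; exact Ideal.mul_mem_left _ _ hb
    have hUU' : U ≤ U' := fun u hu => ⟨1, one_mem _, by simpa using Ideal.mem_sup_left hu⟩
    have hvU' : v ∈ U' := ⟨1, one_mem _, by
      simpa using Ideal.mem_sup_right (Ideal.mem_span_singleton_self v)⟩
    refine hmax U' ⟨?_, ?_⟩ (lt_of_le_of_ne hUU' (fun h => hvU (h ▸ hvU')))
    · rintro w hw a ⟨w', hw', h⟩
      exact ⟨w' * w, mul_mem hw' hw, by rwa [mul_assoc]⟩
    · let h : U' →ₗ[A] (A ⧸ U) :=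
        (Submodule.mkQ U).comp ((LinearMap.mulLeft A w0).comp (Submodule.subtype U'))
      have hh : ∀ u : U', h u = Submodule.mkQ U (w0 * u) := fun u => rfl
      refine GP.ext m x h ?_ ?_ ?_
      · intro z hz
        obtain ⟨z, rfl⟩ := Submodule.mkQ_surjective U z
        rw [← map_smul, Submodule.mkQ_apply, Submodule.Quotient.mk_eq_zero] at hz
        rw [Submodule.mkQ_apply, Submodule.Quotient.mk_eq_zero]
        exact hU1 x hx z hz
      · have hker : ∀ u : LinearMap.ker h, ((u : U') : A) ∈ U := by
          rintro ⟨u, hu⟩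
          rw [LinearMap.mem_ker, hh, Submodule.mkQ_apply, Submodule.Quotient.mk_eq_zero] at hu
          exact hU1 w0 hw0 _ hu
        refine GP.sub m x (LinearMap.codRestrict U
          ((Submodule.subtype U').comp (Submodule.subtype (LinearMap.ker h))) hker) ?_ hU2
        intro a b hab
        have := congrArg Subtype.val hab
        exact Subtype.ext (Subtype.ext this)
      · have hrange : LinearMap.range h ≤ Submodule.span A {Submodule.mkQ U v} := by
          rintro _ ⟨u, rfl⟩
          obtain ⟨a, ha, b, hb, hab⟩ := Submodule.mem_sup.mp (hw0U u u.2)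
          obtain ⟨d, rfl⟩ := Ideal.mem_span_singleton'.mp hb
          rw [hh, ← hab, map_add]
          have : Submodule.mkQ U a = 0 := by
            rw [Submodule.mkQ_apply, Submodule.Quotient.mk_eq_zero]; exact ha
          rw [this, zero_add, Submodule.mem_span_singleton]
          exact ⟨d, by rw [← map_smul, smul_eq_mul]⟩
        have hfin : Module.Finite A (Submodule.span A {Submodule.mkQ U v}) :=
          Module.Finite.span_singleton A _
        exact GP.sub m x (Submodule.inclusion hrange) (Submodule.inclusion_injective hrange)
          (GQ.cyclic m x (hP P hPmin) _ hPv)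
  subst htop
  obtain ⟨c, hc⟩ := hU2
  refine ⟨c, ?_⟩
  rintro n b ⟨k, hk⟩
  obtain ⟨⟨u, hu⟩, he⟩ := hc n ⟨b, trivial⟩ ⟨k, fun w hw => by
    obtain ⟨d, hd⟩ := Ideal.mem_span_singleton.mp (hk w hw)
    refine ⟨⟨d, trivial⟩, ?_⟩
    ext
    simpa using hd⟩
  rw [Ideal.mem_span_singleton]
  exact ⟨u, by simpa [Subtype.ext_iff] using he⟩

/-- The property for `A ⧸ P`, deduced from the one for the local domain `A ⧸ P`. -/
theorem GQ.of_quot [IsLocalRing A] {P : Ideal A} [P.IsPrime] [IsLocalRing (A ⧸ P)] (hxP : x ∉ P)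
    (h : ∃ n, sat (maximalIdeal (A ⧸ P)) (Ideal.span {Ideal.Quotient.mk P x ^ n}) ≤
      Ideal.span {Ideal.Quotient.mk P x}) : GQ (maximalIdeal A) x P := by
  obtain ⟨c, hc⟩ := h
  have hx0 : Ideal.Quotient.mk P x ≠ 0 := fun h => hxP (Ideal.Quotient.eq_zero_iff_mem.mp h)
  have hmle : maximalIdeal (A ⧸ P) ≤ (maximalIdeal A).map (Ideal.Quotient.mk P) := by
    intro z hz
    obtain ⟨b, rfl⟩ := Ideal.Quotient.mk_surjective z
    refine Ideal.mem_map_of_mem _ ?_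
    by_contra hb
    have hu : IsUnit b := by simpa using hb
    exact hz (hu.map _)
  refine ⟨c, fun n r ⟨k, hk⟩ => ?_⟩
  have h1 : Ideal.Quotient.mk P r ∈ sat (maximalIdeal (A ⧸ P))
      (Ideal.span {Ideal.Quotient.mk P x ^ n}) := by
    refine ⟨k, fun w hw => ?_⟩
    have hw' := Ideal.pow_right_mono hmle k hw
    rw [← Ideal.map_pow, Ideal.mem_map_iff_of_surjective _ Ideal.Quotient.mk_surjective] at hw'
    obtain ⟨w', hw2, rfl⟩ := hw'
    obtain ⟨s, hs⟩ := hk w' hw2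
    rw [Ideal.mem_span_singleton]
    refine ⟨Ideal.Quotient.mk P s, ?_⟩
    rw [← map_pow, ← map_mul, ← map_mul, Ideal.Quotient.eq]
    exact hs
  obtain ⟨s, hs⟩ := Ideal.mem_span_singleton.mp (iter_sat _ _ hx0 c hc n h1)
  obtain ⟨s, rfl⟩ := Ideal.Quotient.mk_surjective s
  refine ⟨s, ?_⟩
  rwa [← map_pow, ← map_mul, Ideal.Quotient.eq] at hs

end

end LICP

namespace LICP

open IsLocalRing

section
variable {A : Type*} [CommRing A] [IsNoetherianRing A] [IsLocalRing A]

theorem exists_avoid (Y : Ideal A) : ∃ y ∈ maximalIdeal A, ∀ (j : ℕ) (l : A), y ^ j * l ∈ Y →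
    l ∈ sat (maximalIdeal A) Y := by
  set m := maximalIdeal A with hm
  set K := sat m Y with hK
  obtain ⟨k, hk⟩ := sat_unif m Y
  have hmv : ∀ v, (∀ w ∈ m, w * v ∈ K) → v ∈ K := by
    intro v hv
    refine ⟨k + 1, fun w hw => ?_⟩
    rw [pow_succ] at hw
    refine Submodule.mul_induction_on hw ?_ ?_
    · intro a ha b hb
      rw [mul_assoc]; exact hk a ha _ (hv b hb)
    · intro a b ha hb
      rw [add_mul]; exact add_mem ha hb
  have hns : ¬ ((m : Set A) ⊆ ⋃ p ∈ associatedPrimes A (A ⧸ K), (p : Set A)) := by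
    rw [Ideal.subset_union_prime_finite (associatedPrimes.finite A (A ⧸ K)) (f := fun p => p) ⊥ ⊥
        (fun p hp _ _ => hp.isPrime)]
    rintro ⟨p, hp, hmp⟩
    have hpp : p.IsPrime := hp.isPrime
    have : IsAssociatedPrime p (A ⧸ K) := hp
    rw [isAssociatedPrime_iff] at this
    obtain ⟨-, e, he⟩ := this
    obtain ⟨v, rfl⟩ := Submodule.mkQ_surjective K e
    have hv : ∀ r : A, r ∈ p ↔ r * v ∈ K := by
      intro r
      rw [he, Submodule.mem_colon_singleton, ← map_smul, Submodule.mem_bot, Submodule.mkQ_apply,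
        Submodule.Quotient.mk_eq_zero, smul_eq_mul]
    have h1 := hmv v (fun w hw => (hv w).mp (hmp hw))
    exact hpp.ne_top ((Ideal.eq_top_iff_one p).mpr ((hv 1).mpr (by simpa using h1)))
  rw [Set.not_subset] at hns
  obtain ⟨y, hy, hyn⟩ := hns
  have hyK : ∀ l, y * l ∈ K → l ∈ K := by
    intro l hl
    by_contra hlK
    apply hyn
    have h1 : (Submodule.mkQ K l) ≠ 0 := by
      rw [Ne, Submodule.mkQ_apply, Submodule.Quotient.mk_eq_zero]; exact hlK
    obtain ⟨P, hPa, hP⟩ := exists_le_isAssociatedPrime_of_isNoetherianRing A (Submodule.mkQ K l) h1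
    refine Set.mem_biUnion (show P ∈ associatedPrimes A (A ⧸ K) from hPa) (hP ?_)
    rw [Submodule.mem_colon_singleton, ← map_smul, Submodule.mem_bot, Submodule.mkQ_apply,
        Submodule.Quotient.mk_eq_zero, smul_eq_mul]
    exact hl
  refine ⟨y, hy, fun j l hl => ?_⟩
  have hl' : y ^ j * l ∈ K := le_sat m Y hl
  clear hl
  induction j with
  | zero => simpa using hl'
  | succ j ih =>
    apply ih
    apply hyK
    rwa [← mul_assoc, ← pow_succ']

theorem exists_nzd (hemb : LIC.HasNoEmbeddedPrimes A) (hdim : 2 ≤ ringKrullDim A) :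
    ∃ x ∈ maximalIdeal A, x ∈ nonZeroDivisors A := by
  have hns : ¬ ((maximalIdeal A : Set A) ⊆ ⋃ p ∈ associatedPrimes A A, (p : Set A)) := by
    rw [Ideal.subset_union_prime_finite (associatedPrimes.finite A A) (f := fun p => p) ⊥ ⊥
        (fun p hp _ _ => hp.isPrime)]
    rintro ⟨p, hp, hmp⟩
    have hpp : p.IsPrime := hp.isPrime
    have hpm := hemb p hp
    have he : p = maximalIdeal A := le_antisymm (le_maximalIdeal hpp.ne_top) hmp
    rw [he] at hpm
    have h0 : (maximalIdeal A).height = 0 := Ideal.height_eq_zero_iff.mpr hpm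
    rw [← maximalIdeal_height_eq_ringKrullDim, h0] at hdim
    exact absurd hdim (by decide)
  rw [biUnion_associatedPrimes_eq_compl_nonZeroDivisors, Set.not_subset] at hns
  obtain ⟨x, hx, hxn⟩ := hns
  exact ⟨x, hx, by simpa using hxn⟩

theorem local_thm (hemb : LIC.HasNoEmbeddedPrimes A) (hdim : 2 ≤ ringKrullDim A)
    (hG : ∀ x ∈ maximalIdeal A, x ∈ nonZeroDivisors A → ∀ P ∈ minimalPrimes A,
      GQ (maximalIdeal A) x P) (N : ℕ) :
    ∃ (J : Ideal A) (z α β : A) (N' : ℕ), maximalIdeal A ^ N' ≤ J ∧ α ∈ J ∧ β ∈ J ∧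
      z ^ 2 = α * β ∧ ∀ r, r * z ∈ J → r ∈ maximalIdeal A ^ N := by
  obtain ⟨x, hxm, hx⟩ := exists_nzd hemb hdim
  obtain ⟨c, hc⟩ := GP.ring (maximalIdeal A) x hemb hx (hG x hxm hx)
  have hxc : ∀ n b, x ^ n * b = 0 → b = 0 := fun n b hb =>
    (mem_nonZeroDivisors_iff.mp (pow_mem hx n)).1 b hb
  have hcan : ∀ n a b, x ^ n * a = x ^ n * b → a = b := fun n a b h =>
    sub_eq_zero.mp (hxc n _ (by rw [mul_sub, h, sub_self]))
  obtain ⟨c4, hc4⟩ := ar_nzd (maximalIdeal A) (x ^ c) (hxc c)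
  set m := maximalIdeal A
  let b := c + N + c4
  obtain ⟨y, hym, hy⟩ := exists_avoid (Ideal.span {x ^ (2 * b)})
  have key : ∀ r s t : A, r * (x ^ b * y ^ b) = s * x ^ (2 * b) + t * y ^ (2 * b) → r ∈ m ^ N := by
    intro r s t h
    have h1 : r * x ^ b - t * y ^ b ∈ sat m (Ideal.span {x ^ (2 * b)}) := by
      apply hy b
      rw [Ideal.mem_span_singleton]
      exact ⟨s, by linear_combination h⟩
    obtain ⟨d, hd⟩ := Ideal.mem_span_singleton.mp (hc _ h1)
    have e1 : 2 * b - c = b + (b - c) := by omega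
    rw [e1, pow_add] at hd
    have h2 : x ^ b * t ∈ sat m (Ideal.span {x ^ (2 * b)}) := by
      apply hy b
      rw [Ideal.mem_span_singleton]
      exact ⟨r - x ^ (b - c) * d, by linear_combination (-x ^ b) * hd⟩
    have h3 : t ∈ sat m (Ideal.span {x ^ b}) := by
      obtain ⟨k, hk⟩ := h2
      refine ⟨k, fun w hw => ?_⟩
      obtain ⟨u, hu⟩ := Ideal.mem_span_singleton.mp (hk w hw)
      rw [Ideal.mem_span_singleton]
      refine ⟨u, hcan b _ _ ?_⟩
      linear_combination hu
    obtain ⟨t', ht'⟩ := Ideal.mem_span_singleton.mp (hc _ h3)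
    have e2 : x ^ b = x ^ (b - c) * x ^ c := by
      rw [← pow_add]; congr 1; omega
    have h4 : x ^ c * r = t' * y ^ b + x ^ b * d := by
      apply hcan (b - c)
      rw [ht'] at hd
      linear_combination hd - r * e2
    have h5 : x ^ c * r ∈ m ^ b := by
      rw [h4]
      exact add_mem (Ideal.mul_mem_left _ _ (Ideal.pow_mem_pow hym b))
        (Ideal.mul_mem_right _ _ (Ideal.pow_mem_pow hxm b))
    exact hc4 N r (Ideal.pow_le_pow_right (by omega) h5)
  let J0 : Ideal A := Ideal.span {x ^ (2 * b), y ^ (2 * b)}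
  obtain ⟨N', hN'⟩ := ar_colon m J0 (Ideal.span {x ^ b * y ^ b}) N
  refine ⟨J0 ⊔ m ^ N', x ^ b * y ^ b, x ^ (2 * b), y ^ (2 * b), N', le_sup_right,
    Ideal.mem_sup_left (Ideal.subset_span (by simp)),
    Ideal.mem_sup_left (Ideal.subset_span (by simp)), by ring, fun r hr => ?_⟩
  obtain ⟨r', hr', hrr⟩ := hN' r (fun w hw => by
    obtain ⟨d, rfl⟩ := Ideal.mem_span_singleton'.mp hw
    rw [mul_assoc, mul_comm _ r]
    exact Ideal.mul_mem_left _ _ hr)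
  have h1 := hr' _ (Ideal.mem_span_singleton_self _)
  obtain ⟨s, t, hst⟩ := Ideal.mem_span_pair.mp h1
  have h2 := key r' s t (by rw [hst]; ring)
  have : r = (r - r') + r' := by ring
  rw [this]; exact add_mem hrr h2

end

end LICP

namespace LICP

open IsLocalRing

theorem noeth_of {A C : Type*} [CommRing A] [IsNoetherianRing A] [CommRing C] (f : A →+* C)
    (m : Ideal A)
    (dense : ∀ (j : ℕ) (c : C), ∃ b : A, c - f b ∈ (m.map f) ^ j)
    (haus : ∀ c : C, (∀ j : ℕ, c ∈ (m.map f) ^ j) → c = 0)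
    (lim : ∀ b : ℕ → A, (∀ j, b (j + 1) - b j ∈ m ^ j) →
      ∃ c : C, ∀ j, c - f (b j) ∈ (m.map f) ^ j) : IsNoetherianRing C := by
  have hfm : ∀ (n : ℕ) (a : A), a ∈ m ^ n → f a ∈ (m.map f) ^ n := by
    intro n a ha
    rw [← Ideal.map_pow]; exact Ideal.mem_map_of_mem f ha
  set M := m.map f with hM
  -- approximation inside the powers
  have dense' : ∀ (n : ℕ) (c : C), c ∈ M ^ n → ∃ a ∈ m ^ n, c - f a ∈ M ^ (n + 1) := by
    intro n c hc
    rw [hM, ← Ideal.map_pow] at hc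
    refine Submodule.span_induction ?_ ?_ ?_ ?_ hc
    · rintro _ ⟨a, ha, rfl⟩
      exact ⟨a, ha, by simp⟩
    · exact ⟨0, zero_mem _, by simp⟩
    · rintro x y _ _ ⟨a, ha, hxa⟩ ⟨b, hb, hyb⟩
      refine ⟨a + b, add_mem ha hb, ?_⟩
      have := add_mem hxa hyb
      rw [map_add]
      convert this using 1; ring
    · rintro d x _ ⟨a, ha, hxa⟩
      obtain ⟨d', hd'⟩ := dense 1 d
      refine ⟨d' * a, Ideal.mul_mem_left _ _ ha, ?_⟩
      have e : d • x - f (d' * a) = d * (x - f a) + (d - f d') * f a := by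
        rw [map_mul, smul_eq_mul]; ring
      rw [e]
      refine add_mem (Ideal.mul_mem_left _ _ hxa) ?_
      rw [pow_succ']
      rw [pow_one] at hd'
      exact Ideal.mul_mem_mul hd' (hfm n a ha)
  refine ⟨fun 𝔞 => ?_⟩
  let F : m.Filtration A :=
    { N := fun n =>
        { carrier := {a | a ∈ m ^ n ∧ ∃ r ∈ 𝔞, r - f a ∈ M ^ (n + 1)}
          zero_mem' := ⟨zero_mem _, 0, zero_mem _, by simp⟩
          add_mem' := by
            rintro a b ⟨ha, r, hr, hra⟩ ⟨hb, s, hs, hsb⟩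
            refine ⟨add_mem ha hb, r + s, add_mem hr hs, ?_⟩
            have := add_mem hra hsb
            rw [map_add]
            convert this using 1; ring
          smul_mem' := by
            rintro c a ⟨ha, r, hr, hra⟩
            refine ⟨Ideal.mul_mem_left _ _ ha, f c * r, Ideal.mul_mem_left _ _ hr, ?_⟩
            rw [smul_eq_mul, map_mul, ← mul_sub]
            exact Ideal.mul_mem_left _ _ hra }
      mono := by
        rintro n a ⟨ha, -⟩
        refine ⟨Ideal.pow_le_pow_right (Nat.le_succ n) ha, 0, zero_mem _, ?_⟩
        rw [zero_sub]
        exact neg_mem (hfm _ _ ha)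
      smul_le := by
        intro n
        rw [Submodule.smul_le]
        rintro c hc a ⟨ha, r, hr, hra⟩
        refine ⟨?_, f c * r, Ideal.mul_mem_left _ _ hr, ?_⟩
        · rw [pow_succ', smul_eq_mul]; exact Ideal.mul_mem_mul hc ha
        · rw [smul_eq_mul, map_mul, ← mul_sub, pow_succ' M (n + 1)]
          exact Ideal.mul_mem_mul (Ideal.mem_map_of_mem f hc) hra }
  have hF : F.Stable := by
    refine Ideal.Filtration.Stable.of_le (Ideal.stableFiltration_stable m (⊤ : Ideal A)) ?_
    rintro n a ⟨ha, -⟩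
    show a ∈ (m ^ n • ⊤ : Submodule A A)
    simpa using ha
  obtain ⟨n0, hn0⟩ := hF
  have hFk : ∀ k, F.N (n0 + k) = m ^ k • F.N n0 := by
    intro k
    induction k with
    | zero => simp
    | succ k ih =>
      rw [← add_assoc, ← hn0 (n0 + k) (by omega), ih, ← mul_smul, pow_succ']
  obtain ⟨t, g, hg⟩ := Submodule.fg_iff_exists_fin_generating_family.mp
    (IsNoetherian.noetherian (F.N n0))
  have hgi : ∀ i, ∃ r ∈ 𝔞, r - f (g i) ∈ M ^ (n0 + 1) := by
    intro i
    have : g i ∈ F.N n0 := hg ▸ Submodule.subset_span ⟨i, rfl⟩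
    exact this.2
  choose ρ hρa hρ using hgi
  have hgm : ∀ i, g i ∈ m ^ n0 := by
    intro i
    have : g i ∈ F.N n0 := hg ▸ Submodule.subset_span ⟨i, rfl⟩
    exact this.1
  have step : ∀ (k : ℕ) (r : C), ∃ h : Fin t → A, r ∈ 𝔞 ∧ r ∈ M ^ (n0 + k) →
      (∀ i, h i ∈ m ^ k) ∧ r - ∑ i, f (h i) * ρ i ∈ 𝔞 ∧
        r - ∑ i, f (h i) * ρ i ∈ M ^ (n0 + (k + 1)) := by
    intro k r
    by_cases hr : r ∈ 𝔞 ∧ r ∈ M ^ (n0 + k)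
    · obtain ⟨a, ham, hra⟩ := dense' _ _ hr.2
      have ha : a ∈ F.N (n0 + k) := ⟨ham, r, hr.1, hra⟩
      rw [hFk, ← hg, Submodule.mem_ideal_smul_span_iff_exists_sum] at ha
      obtain ⟨h, hh, hsum⟩ := ha
      refine ⟨h, fun _ => ⟨hh, ?_, ?_⟩⟩
      · exact sub_mem hr.1 (sum_mem fun i _ => Ideal.mul_mem_left _ _ (hρa i))
      · have e : r - ∑ i, f (h i) * ρ i = (r - f a) - ∑ i, f (h i) * (ρ i - f (g i)) := by
          have : f a = ∑ i, f (h i) * f (g i) := by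
            rw [← hsum, Finsupp.sum_fintype _ _ (by simp), map_sum]
            simp
          rw [this]
          simp only [mul_sub, Finset.sum_sub_distrib]; ring
        rw [e]
        refine sub_mem hra (sum_mem fun i _ => ?_)
        have := Ideal.mul_mem_mul (hfm k _ (hh i)) (hρ i)
        rw [← pow_add] at this
        convert this using 2; omega
    · exact ⟨0, fun h => absurd h hr⟩
  choose H hH using step
  have hsub : 𝔞 ⊓ M ^ n0 = Ideal.span (Set.range ρ) ⊓ M ^ n0 := by
    apply le_antisymm
    · rintro r ⟨hr, hrM⟩
      refine ⟨?_, hrM⟩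
      let R : ℕ → C := fun k => Nat.rec r (fun k q => q - ∑ i, f (H k q i) * ρ i) k
      have hR0 : R 0 = r := rfl
      have hRs : ∀ k, R (k + 1) = R k - ∑ i, f (H k (R k) i) * ρ i := fun k => rfl
      have hR : ∀ k, R k ∈ 𝔞 ∧ R k ∈ M ^ (n0 + k) := by
        intro k
        induction k with
        | zero => exact ⟨hr, hrM⟩
        | succ k ih => rw [hRs]; exact (hH k _ ih).2
      let S : Fin t → ℕ → A := fun i k => ∑ j ∈ Finset.range k, H j (R j) i
      have hlim : ∀ i, ∃ c : C, ∀ j, c - f (S i j) ∈ M ^ j := by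
        intro i
        apply lim
        intro j
        simp only [S, Finset.sum_range_succ, add_sub_cancel_left]
        exact (hH j _ (hR j)).1 i
      choose c hc using hlim
      have hRS : ∀ k, r = R k + ∑ i, f (S i k) * ρ i := by
        intro k
        induction k with
        | zero => simp [S, hR0]
        | succ k ih =>
          rw [hRs]
          simp only [S, Finset.sum_range_succ, map_add, add_mul, Finset.sum_add_distrib]
          conv_lhs => rw [ih]
          ring
      have : r - ∑ i, c i * ρ i = 0 := by
        apply haus
        intro k
        have e : r - ∑ i, c i * ρ i = R k - ∑ i, (c i - f (S i k)) * ρ i := by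
          conv_lhs => rw [hRS k]
          simp only [sub_mul, Finset.sum_sub_distrib]; ring
        rw [e]
        exact sub_mem (Ideal.pow_le_pow_right (by omega) (hR k).2)
          (sum_mem fun i _ => Ideal.mul_mem_right _ _ (hc i k))
      rw [sub_eq_zero.mp this]
      exact sum_mem fun i _ => Ideal.mul_mem_left _ _ (Ideal.subset_span ⟨i, rfl⟩)
    · refine le_inf (inf_le_left.trans ?_) inf_le_right
      rw [Ideal.span_le]
      rintro _ ⟨i, rfl⟩
      exact hρa i
  have hspan : Ideal.span (Set.range ρ) ≤ M ^ n0 := by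
    rw [Ideal.span_le]
    rintro _ ⟨i, rfl⟩
    have := add_mem (Ideal.pow_le_pow_right (Nat.le_succ n0) (hρ i)) (hfm _ _ (hgm i))
    simpa using this
  let _ := f.toAlgebra
  have hN : IsNoetherian C (C ⧸ M ^ n0) := by
    have : IsNoetherian A (C ⧸ M ^ n0) := by
      refine isNoetherian_of_surjective
        (Algebra.linearMap A (C ⧸ M ^ n0)) (LinearMap.range_eq_top.mpr ?_)
      intro z
      obtain ⟨c, rfl⟩ := Ideal.Quotient.mk_surjective z
      obtain ⟨b, hb⟩ := dense n0 c
      exact ⟨b, ((Ideal.Quotient.eq).mpr hb).symm⟩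
    exact isNoetherian_of_tower A this
  refine Submodule.fg_of_fg_map_of_fg_inf_ker (Submodule.mkQ (M ^ n0)) (IsNoetherian.noetherian _) ?_
  rw [Submodule.ker_mkQ, hsub, inf_eq_left.mpr hspan]
  exact Submodule.fg_span (Set.finite_range ρ)

theorem mem_pow_iff {A : Type*} [CommRing A] [IsNoetherianRing A] (m : Ideal A) (n : ℕ)
    (c : AdicCompletion m A) :
    c ∈ (m.map (algebraMap A (AdicCompletion m A))) ^ n ↔ AdicCompletion.evalₐ m n c = 0 := by
  rw [← Ideal.map_pow, ← Submodule.restrictScalars_mem A, ← Ideal.smul_top_eq_map,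
    AdicCompletion.pow_smul_top_eq_ker_eval m.fg_of_isNoetherianRing, LinearMap.mem_ker]
  rw [← AdicCompletion.factor_eval_eq_evalₐ m c (by simp)]
  constructor
  · intro h
    rw [h, map_zero]
  · intro h
    obtain ⟨a, ha⟩ := Submodule.mkQ_surjective _ (AdicCompletion.eval m A n c)
    rw [← ha] at h ⊢
    have : a ∈ m ^ n := Ideal.Quotient.eq_zero_iff_mem.mp h
    rw [Submodule.mkQ_apply, Submodule.Quotient.mk_eq_zero]
    simpa using this

theorem CL.completion (A : Type*) [CommRing A] [IsNoetherianRing A] [IsLocalRing A] :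
    CL (algebraMap A (AdicCompletion (maximalIdeal A) A)) := by
  set m := maximalIdeal A with hm
  have dense : ∀ (j : ℕ) (c : AdicCompletion m A), ∃ b : A,
      c - algebraMap A (AdicCompletion m A) b ∈ (m.map (algebraMap A (AdicCompletion m A))) ^ j := by
    intro j c
    obtain ⟨b, hb⟩ := Ideal.Quotient.mk_surjective (AdicCompletion.evalₐ m j c)
    refine ⟨b, ?_⟩
    rw [mem_pow_iff, map_sub, AlgHom.commutes, ← hb]
    exact sub_self _
  have lim : ∀ b : ℕ → A, (∀ j, b (j + 1) - b j ∈ m ^ j) →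
    ∃ c : AdicCompletion m A, ∀ j, c - algebraMap A (AdicCompletion m A) (b j) ∈
      (m.map (algebraMap A (AdicCompletion m A))) ^ j := by
    intro b hb
    let s : AdicCompletion.AdicCauchySequence m A := AdicCompletion.AdicCauchySequence.mk m A b
      (fun n => by
        rw [SModEq.sub_mem]
        have := neg_mem (hb n)
        simpa using this)
    refine ⟨AdicCompletion.mk m A s, fun j => ?_⟩
    rw [mem_pow_iff, map_sub, AlgHom.commutes, AdicCompletion.evalₐ_mk]
    exact sub_self _
  have haus : ∀ c : AdicCompletion m A, (∀ j : ℕ, c ∈ (m.map (algebraMap A (AdicCompletion m A))) ^ j)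
      → c = 0 := by
    intro c hc
    apply AdicCompletion.ext_evalₐ
    intro n
    rw [map_zero]
    exact (mem_pow_iff m n c).mp (hc n)
  refine ⟨noeth_of _ m dense haus lim, inferInstance, ?_, dense, ?_, lim⟩
  · intro x hx
    rw [← AdicCompletion.maximalIdeal_eq_map] at hx
    exact hx
  · intro j b hb
    rw [mem_pow_iff, AlgHom.commutes] at hb
    exact Ideal.Quotient.eq_zero_iff_mem.mp hb

end LICP

namespace LICP

open IsLocalRing

theorem max_quot {A : Type*} [CommRing A] [IsLocalRing A] (P : Ideal A) [IsLocalRing (A ⧸ P)] :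
    maximalIdeal (A ⧸ P) = (maximalIdeal A).map (Ideal.Quotient.mk P) := by
  apply le_antisymm
  · intro z hz
    obtain ⟨b, rfl⟩ := Ideal.Quotient.mk_surjective z
    refine Ideal.mem_map_of_mem _ ?_
    by_contra hb
    have hu : IsUnit b := by simpa using hb
    exact hz (hu.map _)
  · rw [Ideal.map_le_iff_le_comap]
    intro b hb
    have hP : P ≤ maximalIdeal A := le_maximalIdeal (fun h => by
      subst h
      exact not_subsingleton (A ⧸ (⊤ : Ideal A)) (Ideal.Quotient.subsingleton_iff.mpr rfl))
    rintro hu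
    obtain ⟨c, hc⟩ := hu.exists_right_inv
    obtain ⟨c, rfl⟩ := Ideal.Quotient.mk_surjective c
    rw [← map_mul, ← map_one (Ideal.Quotient.mk P), Ideal.Quotient.eq] at hc
    have h1 := sub_mem (Ideal.mul_mem_right c _ hb) (hP hc)
    rw [sub_sub_cancel] at h1
    exact (maximalIdeal.isMaximal A).ne_top ((Ideal.eq_top_iff_one _).mpr h1)

theorem CL.quot {A C : Type*} [CommRing A] [CommRing C] [IsNoetherianRing A] [IsLocalRing A]
    {f : A →+* C} (h : CL f) (P : Ideal A) [IsLocalRing (A ⧸ P)] (hP : P ≤ maximalIdeal A)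
    (f' : A ⧸ P →+* C ⧸ P.map f)
    (hf' : ∀ a, f' (Ideal.Quotient.mk P a) = Ideal.Quotient.mk (P.map f) (f a)) :
    CL f' := by
  have := h.noeth
  have := h.loc
  have hmax : (maximalIdeal (A ⧸ P)).map f' =
      ((maximalIdeal A).map f).map (Ideal.Quotient.mk (P.map f)) := by
    have hc : f'.comp (Ideal.Quotient.mk P) = (Ideal.Quotient.mk (P.map f)).comp f :=
      RingHom.ext hf'
    rw [max_quot, Ideal.map_map, Ideal.map_map, hc]
  have hPC : P.map f ≤ maximalIdeal C := (Ideal.map_mono hP).trans h.le_max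
  have hnt : Nontrivial (C ⧸ P.map f) := Ideal.Quotient.nontrivial_iff.mpr (fun h => by
    rw [h] at hPC
    exact (maximalIdeal.isMaximal C).ne_top (top_le_iff.mp hPC))
  have hloc : IsLocalRing (C ⧸ P.map f) :=
    IsLocalRing.of_surjective' _ Ideal.Quotient.mk_surjective
  refine ⟨inferInstance, hloc, ?_, ?_, ?_, ?_⟩
  · intro x hx
    rw [hmax, h.max_eq, ← max_quot] at hx
    exact hx
  · intro j c
    obtain ⟨c, rfl⟩ := Ideal.Quotient.mk_surjective c
    obtain ⟨b, hb⟩ := h.dense j c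
    refine ⟨Ideal.Quotient.mk P b, ?_⟩
    rw [hf', ← map_sub, hmax, ← Ideal.map_pow]
    exact Ideal.mem_map_of_mem _ hb
  · intro j b hb
    obtain ⟨b, rfl⟩ := Ideal.Quotient.mk_surjective b
    rw [hf', hmax, ← Ideal.map_pow,
      Ideal.mem_map_iff_of_surjective _ Ideal.Quotient.mk_surjective] at hb
    obtain ⟨c, hc, hcb⟩ := hb
    rw [Ideal.Quotient.eq] at hcb
    have h1 : f b ∈ (maximalIdeal A ^ j ⊔ P).map f := by
      rw [Ideal.map_sup, Ideal.map_pow]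
      have := sub_mem (Ideal.mem_sup_left hc : c ∈ (maximalIdeal A).map f ^ j ⊔ P.map f)
        (Ideal.mem_sup_right hcb)
      simpa using this
    obtain ⟨u, hu, v, hv, huv⟩ := Submodule.mem_sup.mp (h.contr _ _ h1)
    rw [max_quot, ← Ideal.map_pow, ← huv, map_add, Ideal.Quotient.eq_zero_iff_mem.mpr hv, add_zero]
    exact Ideal.mem_map_of_mem _ hu
  · intro b hb
    have : ∀ j, ∃ d ∈ maximalIdeal A ^ j, Ideal.Quotient.mk P d = b (j + 1) - b j := by
      intro j
      have := hb j
      rw [max_quot, ← Ideal.map_pow,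
        Ideal.mem_map_iff_of_surjective _ Ideal.Quotient.mk_surjective] at this
      exact this
    choose d hd hdb using this
    obtain ⟨a0, ha0⟩ := Ideal.Quotient.mk_surjective (b 0)
    have hab : ∀ j, Ideal.Quotient.mk P (a0 + ∑ i ∈ Finset.range j, d i) = b j := by
      intro j
      induction j with
      | zero => simpa using ha0
      | succ j ih =>
        rw [Finset.sum_range_succ, ← add_assoc, map_add, ih, hdb]; ring
    obtain ⟨c, hc⟩ := h.lim (fun j => a0 + ∑ i ∈ Finset.range j, d i) (fun j => by
      have e : (a0 + ∑ i ∈ Finset.range (j + 1), d i) - (a0 + ∑ i ∈ Finset.range j, d i) = d j := by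
        rw [Finset.sum_range_succ]; ring
      simp only [e]; exact hd j)
    refine ⟨Ideal.Quotient.mk _ c, fun j => ?_⟩
    rw [← hab j, hf', ← map_sub, hmax, ← Ideal.map_pow]
    exact Ideal.mem_map_of_mem _ (hc j)

section
universe u

theorem regular_domain_aux (d : ℕ) : ∀ (A : Type u) [CommRing A] [IsNoetherianRing A]
    [IsLocalRing A] (s : Finset A), s.card ≤ d → Ideal.span (s : Set A) = maximalIdeal A →
    (d : WithBot ℕ∞) ≤ ringKrullDim A → IsDomain A := by
  induction d with
  | zero =>
    intro A _ _ _ s hs hm _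
    have : s = ∅ := by simpa using hs
    subst this
    have hm' : maximalIdeal A = ⊥ := by rw [← hm]; simp
    exact (IsLocalRing.isField_iff_maximalIdeal_eq.mpr hm').isDomain
  | succ d ih =>
    classical
    intro A _ _ _ s hs hm hdim
    have hmin : maximalIdeal A ∉ minimalPrimes A := by
      intro hpm
      have h0 : (maximalIdeal A).height = 0 := Ideal.height_eq_zero_iff.mpr hpm
      rw [← maximalIdeal_height_eq_ringKrullDim, h0] at hdim
      have : ((d + 1 : ℕ) : ℕ∞) ≤ 0 := by exact_mod_cast hdim
      simp at this
    have hns : ¬ ((maximalIdeal A : Set A) ⊆ ⋃ p ∈ insert (maximalIdeal A * maximalIdeal A)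
        (minimalPrimes A), (p : Set A)) := by
      rw [Ideal.subset_union_prime_finite ((minimalPrimes.finite_of_isNoetherianRing A).insert _)
        (f := fun p => p) (maximalIdeal A * maximalIdeal A) (maximalIdeal A * maximalIdeal A) ?_]
      · rintro ⟨p, hp, hmp⟩
        rcases hp with rfl | hp
        · have h0 : maximalIdeal A = ⊥ := by
            refine Submodule.eq_bot_of_le_smul_of_le_jacobson_bot (maximalIdeal A) _
              (IsNoetherian.noetherian _) hmp ?_
            exact (IsLocalRing.jacobson_eq_maximalIdeal ⊥ bot_ne_top).ge
          apply hmin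
          rw [h0]
          have : (⊥ : Ideal A).IsPrime := h0 ▸ (maximalIdeal.isMaximal A).isPrime
          exact ⟨⟨this, bot_le⟩, fun _ _ _ => bot_le⟩
        · have hpp : p.IsPrime := hp.1.1
          have he : p = maximalIdeal A := le_antisymm (le_maximalIdeal hpp.ne_top) hmp
          exact hmin (he ▸ hp)
      · intro p hp h1 _
        rcases hp with rfl | hp
        · exact absurd rfl h1
        · exact hp.1.1
    rw [Set.not_subset] at hns
    obtain ⟨x, hxm, hxn⟩ := hns
    have hx2 : x ∉ maximalIdeal A * maximalIdeal A := fun h =>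
      hxn (Set.mem_biUnion (Set.mem_insert _ _) h)
    have hxP : ∀ P ∈ minimalPrimes A, x ∉ P := fun P hP h =>
      hxn (Set.mem_biUnion (Set.mem_insert_of_mem _ hP) h)
    have hxs : x ∈ Submodule.span A (s : Set A) := by
      have := hxm
      rw [SetLike.mem_coe, ← hm] at this
      exact this
    obtain ⟨g, -, hg⟩ := Submodule.mem_span_finset.mp hxs
    have hsm : ∀ a ∈ s, a ∈ maximalIdeal A := fun a ha => hm ▸ Ideal.subset_span ha
    obtain ⟨a0, ha0, hu⟩ : ∃ a ∈ s, IsUnit (g a) := by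
      by_contra hcon
      push Not at hcon
      apply hx2
      rw [← hg]
      exact sum_mem fun a ha => Ideal.mul_mem_mul (hcon a ha) (hsm a ha)
    have hle : Ideal.span {x} ≤ maximalIdeal A := by
      rw [Ideal.span_le]; simpa using hxm
    have hnt : Nontrivial (A ⧸ Ideal.span {x}) := Ideal.Quotient.nontrivial_iff.mpr (fun h => by
      rw [h] at hle
      exact (maximalIdeal.isMaximal A).ne_top (top_le_iff.mp hle))
    have hloc : IsLocalRing (A ⧸ Ideal.span {x}) :=
      IsLocalRing.of_surjective' _ Ideal.Quotient.mk_surjective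
    have hdom : IsDomain (A ⧸ Ideal.span {x}) := by
      refine ih _ ((s.erase a0).image (Ideal.Quotient.mk (Ideal.span {x}))) ?_ ?_ ?_
      · refine Finset.card_image_le.trans ?_
        rw [Finset.card_erase_of_mem ha0]; omega
      · rw [max_quot, ← hm, Ideal.map_span]
        apply le_antisymm
        · apply Ideal.span_mono
          rw [Finset.coe_image]
          exact Set.image_mono (Finset.coe_subset.mpr (Finset.erase_subset _ _))
        · rw [Ideal.span_le]
          rintro _ ⟨a, ha, rfl⟩
          have hmem : ∀ a ∈ s.erase a0, Ideal.Quotient.mk (Ideal.span {x}) a ∈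
              Ideal.span (((s.erase a0).image (Ideal.Quotient.mk (Ideal.span {x})) : Finset _) :
                Set (A ⧸ Ideal.span {x})) := fun a ha =>
            Ideal.subset_span (Finset.mem_coe.mpr (Finset.mem_image_of_mem _ ha))
          by_cases hne : a = a0
          · subst hne
            have h1 : Ideal.Quotient.mk (Ideal.span {x}) (g a) * Ideal.Quotient.mk _ a =
                - ∑ b ∈ s.erase a, Ideal.Quotient.mk _ (g b) * Ideal.Quotient.mk _ b := by
              rw [← Finset.add_sum_erase s _ ha0] at hg
              have h2 : Ideal.Quotient.mk (Ideal.span {x}) x = 0 :=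
                Ideal.Quotient.eq_zero_iff_mem.mpr (Ideal.mem_span_singleton_self x)
              have h3 := congrArg (Ideal.Quotient.mk (Ideal.span {x})) hg
              rw [h2, map_add, map_sum] at h3
              simp only [smul_eq_mul, map_mul] at h3
              exact eq_neg_of_add_eq_zero_left h3
            rw [SetLike.mem_coe, ← Ideal.unit_mul_mem_iff_mem _ (hu.map (Ideal.Quotient.mk
              (Ideal.span {x}))), h1]
            exact neg_mem (sum_mem fun b hb => Ideal.mul_mem_left _ _ (hmem b hb))
          · exact hmem a (Finset.mem_erase.mpr ⟨hne, ha⟩)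
      · have h1 := ringKrullDim_le_ringKrullDim_quotient_add_encard ({x} : Set A) (by
          rw [IsLocalRing.ringJacobson_eq_maximalIdeal]; simpa using hxm)
        have h2 := hdim.trans h1
        rw [Set.encard_singleton] at h2
        obtain ⟨e, he⟩ := WithBot.ne_bot_iff_exists.mp
          (ringKrullDim_ne_bot (R := A ⧸ Ideal.span {x}))
        rw [← he] at h2 ⊢
        have h3 : ((d + 1 : ℕ) : ℕ∞) ≤ e + 1 := by exact_mod_cast h2
        rw [Nat.cast_add, Nat.cast_one] at h3
        have h4 : (d : ℕ∞) ≤ e := (ENat.add_le_add_iff_right (by simp)).mp h3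
        exact_mod_cast h4
    have hpr : (Ideal.span {x}).IsPrime := (Ideal.Quotient.isDomain_iff_prime _).mp hdom
    obtain ⟨P, hP, hPx⟩ := Ideal.exists_minimalPrimes_le (I := (⊥ : Ideal A)) (J := Ideal.span {x})
      bot_le
    have hPp : P.IsPrime := hP.1.1
    have hP0 : P = ⊥ := by
      refine Submodule.eq_bot_of_le_smul_of_le_jacobson_bot (maximalIdeal A) _
              (IsNoetherian.noetherian _) ?_
                (IsLocalRing.jacobson_eq_maximalIdeal ⊥ bot_ne_top).ge
      intro p hp
      obtain ⟨a, rfl⟩ := Ideal.mem_span_singleton.mp (hPx hp)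
      exact Ideal.mul_mem_mul hxm ((hPp.mem_or_mem hp).resolve_left (hxP P hP))
    subst hP0
    exact IsDomain.of_bot_isPrime A

theorem regular_domain {A : Type u} [CommRing A] (h : LIC.IsRegularLocalRing A) : IsDomain A := by
  obtain ⟨hn, hl, s, hs, hd⟩ := h
  exact regular_domain_aux s.card A s le_rfl hs hd.le

theorem regular_reduced {A : Type u} [CommRing A] (h : LIC.IsRegularRing A) : IsReduced A := by
  apply isReduced_ofLocalizationMaximal
  intro J hJ
  have := regular_domain (h J hJ.isPrime)
  infer_instance

end

end LICP

namespace LICP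

open IsLocalRing

section
universe u
open scoped TensorProduct

theorem finite_aux (B K : Type*) [CommRing B] [IsDomain B] [Field K] [Algebra B K]
    [IsFractionRing B K] [FaithfulSMul B K] :
    letI := FractionRing.liftAlgebra B K
    FiniteDimensional (FractionRing B) K := by
  letI := FractionRing.liftAlgebra B K
  have hst : IsScalarTower B (FractionRing B) K := FractionRing.isScalarTower_liftAlgebra B K
  refine Module.Finite.of_surjective (Algebra.linearMap (FractionRing B) K) ?_
  intro k
  obtain ⟨a, b, -, rfl⟩ := IsFractionRing.div_surjective (A := B) k
  refine ⟨algebraMap B (FractionRing B) a / algebraMap B (FractionRing B) b, ?_⟩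
  rw [Algebra.linearMap_apply, map_div₀, ← IsScalarTower.algebraMap_apply,
    ← IsScalarTower.algebraMap_apply]

theorem reduced_fiber {A S : Type u} [CommRing A] [IsNoetherianRing A] [IsLocalRing A] [CommRing S]
    [Algebra A S] (h : CL (algebraMap A S)) (hG : LIC.HasGeometricallyRegularFibers.{u} A S)
    (P : Ideal A) [hP : P.IsPrime] : IsReduced (S ⧸ P.map (algebraMap A S)) := by
  have hloc : IsLocalRing (A ⧸ P) := IsLocalRing.of_surjective' _ Ideal.Quotient.mk_surjective
  let f' : A ⧸ P →+* S ⧸ P.map (algebraMap A S) :=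
    Ideal.quotientMap _ (algebraMap A S) Ideal.le_comap_map
  have hf' : ∀ a, f' (Ideal.Quotient.mk P a) =
      Ideal.Quotient.mk (P.map (algebraMap A S)) (algebraMap A S a) := fun a =>
    Ideal.quotientMap_mk
  have hCL := h.quot P (le_maximalIdeal hP.ne_top) f' hf'
  let K := FractionRing (A ⧸ P)
  have hreg : LIC.IsRegularRing (K ⊗[A] S) := by
    have hnz : NoZeroSMulDivisors (A ⧸ P) K := ⟨fun {c x} hcx => by
      rw [Algebra.smul_def, mul_eq_zero] at hcx
      exact hcx.imp (fun h => (map_eq_zero_iff _ (IsFractionRing.injective (A ⧸ P) K)).mp h) id⟩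
    exact hG P hP K inferInstance inferInstance hnz inferInstance inferInstance
      (finite_aux (A ⧸ P) K)
  have hred := regular_reduced hreg
  let T := (nonZeroDivisors (A ⧸ P)).map f'
  let Q := Localization T
  let g : S ⧸ P.map (algebraMap A S) →+* Q := algebraMap _ Q
  have hu : ∀ y : nonZeroDivisors (A ⧸ P), IsUnit ((g.comp f') y) := fun y =>
    IsLocalization.map_units Q (⟨f' y, Submonoid.mem_map_of_mem _ y.2⟩ : T)
  let k0 : K →+* Q := IsLocalization.lift hu
  have hk0 : ∀ a, k0 (algebraMap (A ⧸ P) K a) = g (f' a) := fun a => IsLocalization.lift_eq hu a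
  let k1 : K →ₐ[A] Q :=
    { k0 with
      commutes' := by
        intro a
        change k0 (algebraMap (A ⧸ P) K (Ideal.Quotient.mk P a)) = _
        rw [hk0, hf']
        rfl }
  let s1 : S →ₐ[A] Q :=
    { g.comp (Ideal.Quotient.mk (P.map (algebraMap A S))) with
      commutes' := by
        intro a
        rfl }
  let Φ := Algebra.TensorProduct.productMap k1 s1
  refine ⟨fun c hc => ?_⟩
  obtain ⟨c, rfl⟩ := Ideal.Quotient.mk_surjective c
  obtain ⟨n, hn⟩ := hc
  rw [← map_pow, Ideal.Quotient.eq_zero_iff_mem] at hn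
  have hker : ∀ s ∈ P.map (algebraMap A S), (1 : K) ⊗ₜ[A] s = 0 := by
    intro s hs
    have : P.map (algebraMap A S) ≤ RingHom.ker
        (Algebra.TensorProduct.includeRight : S →ₐ[A] K ⊗[A] S) := by
      rw [Ideal.map_le_iff_le_comap]
      intro a ha
      rw [Ideal.mem_comap, RingHom.mem_ker, AlgHom.commutes]
      rw [Algebra.TensorProduct.algebraMap_apply, IsScalarTower.algebraMap_apply A (A ⧸ P) K,
        Ideal.Quotient.algebraMap_eq, Ideal.Quotient.eq_zero_iff_mem.mpr ha, map_zero,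
        TensorProduct.zero_tmul]
    exact this hs
  have h1 : ((1 : K) ⊗ₜ[A] c) = 0 := by
    apply hred.eq_zero
    refine ⟨n, ?_⟩
    rw [Algebra.TensorProduct.tmul_pow, one_pow]
    exact hker _ hn
  have h2 : g (Ideal.Quotient.mk _ c) = 0 := by
    have := congrArg Φ h1
    rw [Algebra.TensorProduct.productMap_apply_tmul, map_one, one_mul, map_zero] at this
    exact this
  rw [IsLocalization.map_eq_zero_iff T] at h2
  obtain ⟨⟨_, y, hy, rfl⟩, hyc⟩ := h2
  exact hCL.nzd y (fun b hb => (mem_nonZeroDivisors_iff.mp hy).1 b hb) _ hyc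

theorem GQ_all {A : Type u} [CommRing A] [IsNoetherianRing A] [IsLocalRing A]
    (hex : LIC.IsExcellentRing.{u} A) (heq : LIC.IsEquidimensionalRing A)
    (hdim : 2 ≤ ringKrullDim A) (x : A) (hxm : x ∈ maximalIdeal A) (hx : x ∈ nonZeroDivisors A)
    (P : Ideal A) (hPm : P ∈ minimalPrimes A) : GQ (maximalIdeal A) x P := by
  have hP : P.IsPrime := hPm.1.1
  have hloc : IsLocalRing (A ⧸ P) := IsLocalRing.of_surjective' _ Ideal.Quotient.mk_surjective
  have hxP : x ∉ P := fun hxP => Set.disjoint_left.mp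
    (Ideal.disjoint_nonZeroDivisors_of_mem_minimalPrimes hPm) hxP hx
  apply GQ.of_quot x hxP
  let q := maximalIdeal A
  have hq : q.IsPrime := inferInstance
  let A' := Localization.AtPrime q
  have hN' : IsNoetherianRing A' := IsLocalization.isNoetherianRing q.primeCompl A' inferInstance
  let e : A ≃+* A' := (IsLocalization.atUnits A q.primeCompl (S := A') (fun y hy => by
    by_contra hc
    exact hy hc)).toRingEquiv
  let P' : Ideal A' := P.map (e : A →+* A')
  have hP' : P'.IsPrime := Ideal.map_isPrime_of_equiv e
  let ε : A ⧸ P ≃+* A' ⧸ P' := Ideal.quotientEquiv P P' e rfl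
  have hloc' : IsLocalRing (A' ⧸ P') := IsLocalRing.of_surjective' _ Ideal.Quotient.mk_surjective
  let S := AdicCompletion (maximalIdeal A') A'
  let f' : A' ⧸ P' →+* S ⧸ P'.map (algebraMap A' S) :=
    Ideal.quotientMap _ (algebraMap A' S) Ideal.le_comap_map
  have hCL : CL f' := (CL.completion A').quot P' (le_maximalIdeal hP'.ne_top) f'
    (fun a => Ideal.quotientMap_mk)
  have hCL2 := hCL.comp_equiv ε
  have hred : IsReduced (S ⧸ P'.map (algebraMap A' S)) :=
    reduced_fiber (CL.completion A') (hex.2.2.1 q hq) P'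
  refine DL hCL2 hred _ (fun h => hxP (Ideal.Quotient.eq_zero_iff_mem.mp h)) ?_ ?_
  · rw [max_quot]
    exact Ideal.mem_map_of_mem _ hxm
  · intro y a l Q D
    refine D.false ?_ (by rw [heq P hPm]; exact hdim)
    refine hex.2.1 (Polynomial (A ⧸ P)) inferInstance inferInstance ?_
    exact Algebra.FiniteType.trans (S := A ⧸ P) inferInstance inferInstance

theorem local_good {A : Type u} [CommRing A] [IsNoetherianRing A] [IsLocalRing A]
    (hex : LIC.IsExcellentRing.{u} A) (heq : LIC.IsEquidimensionalRing A)
    (hemb : LIC.HasNoEmbeddedPrimes A)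
    (hdim : 2 ≤ ringKrullDim A) (N : ℕ) :
    ∃ (J : Ideal A) (z α β : A) (N' : ℕ), maximalIdeal A ^ N' ≤ J ∧ α ∈ J ∧ β ∈ J ∧
      z ^ 2 = α * β ∧ ∀ r, r * z ∈ J → r ∈ maximalIdeal A ^ N :=
  local_thm hemb hdim (GQ_all hex heq hdim) N
end

end LICP

namespace LICP

open IsLocalRing

section
universe u

theorem map_top_of_not_le {R : Type u} [CommRing R] (p : Ideal R) [p.IsPrime] (L : Ideal R)
    (h : ¬ L ≤ p) : L.map (algebraMap R (Localization.AtPrime p)) = ⊤ := by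
  obtain ⟨s, hs, hsp⟩ := SetLike.not_le_iff_exists.mp h
  exact Ideal.eq_top_of_isUnit_mem _ (Ideal.mem_map_of_mem _ hs)
    (IsLocalization.map_units (Localization.AtPrime p) (⟨s, hsp⟩ : p.primeCompl))

theorem piece {R : Type u} [CommRing R] [IsNoetherianRing R] (I q : Ideal R) (hIq : I ≤ q)
    (hq : q.IsPrimary) :
    ∃ (L : Ideal R) (z : R), (∀ r, r * z ∈ L → r ∈ q) ∧
      ∀ (p : Ideal R) (hp : p.IsPrime), p ∈ I.minimalPrimes → @LIC.GoodPrime R _ p hp →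
        ∃ α ∈ L.map (algebraMap R (Localization.AtPrime p)),
        ∃ β ∈ L.map (algebraMap R (Localization.AtPrime p)),
          algebraMap R (Localization.AtPrime p) z ^ 2 = α * β := by
  have hP : q.radical.IsPrime := Ideal.isPrime_radical hq
  have hIP : I ≤ q.radical := hIq.trans Ideal.le_radical
  have htriv : ∀ (L : Ideal R) (z : R) (p : Ideal R) (hp : p.IsPrime), ¬ L ≤ p →
      ∃ α ∈ L.map (algebraMap R (Localization.AtPrime p)),
        ∃ β ∈ L.map (algebraMap R (Localization.AtPrime p)),
          algebraMap R (Localization.AtPrime p) z ^ 2 = α * β := by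
    intro L z p hp hL
    rw [map_top_of_not_le p L hL]
    exact ⟨_, Submodule.mem_top, 1, Submodule.mem_top, (mul_one _).symm⟩
  by_cases hgood : q.radical ∈ I.minimalPrimes ∧ @LIC.GoodPrime R _ q.radical hP
  · obtain ⟨hmin, hdim, hex, heq, hemb⟩ := hgood
    set P := q.radical with hPdef
    have hN : IsNoetherianRing (Localization.AtPrime P) :=
      IsLocalization.isNoetherianRing P.primeCompl _ inferInstance
    obtain ⟨N, hN⟩ := Ideal.exists_pow_le_of_le_radical_of_fg (I := P) (J := q) le_rfl
      (IsNoetherian.noetherian _)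
    obtain ⟨J, z, α, β, N', hJ, hα, hβ, hz, hr⟩ := local_good hex heq hemb hdim N
    obtain ⟨z0, s, rfl⟩ := IsLocalization.exists_mk'_eq P.primeCompl z
    have hz0 : algebraMap R (Localization.AtPrime P) z0 =
        algebraMap R _ (s : R) * IsLocalization.mk' (Localization.AtPrime P) z0 s := by
      rw [IsLocalization.mk'_spec']
    have hsu : IsUnit (algebraMap R (Localization.AtPrime P) (s : R)) :=
      IsLocalization.map_units _ s
    have hmP := Localization.AtPrime.map_eq_maximalIdeal (I := P)
    refine ⟨J.comap (algebraMap R (Localization.AtPrime P)), z0, ?_, ?_⟩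
    · intro r hrz
      rw [Ideal.mem_comap, map_mul, hz0, mul_left_comm, Ideal.unit_mul_mem_iff_mem _ hsu] at hrz
      have h1 := hr _ hrz
      rw [← hmP, ← Ideal.map_pow] at h1
      have h2 := Ideal.map_mono hN h1
      rw [IsLocalization.algebraMap_mem_map_algebraMap_iff P.primeCompl] at h2
      obtain ⟨t, ht, htr⟩ := h2
      rw [mul_comm] at htr
      exact ((Ideal.isPrimary_iff.mp hq).2 htr).resolve_right ht
    · intro p hp hpm hpg
      by_cases hPp : P = p
      · subst hPp
        rw [IsLocalization.map_comap P.primeCompl]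
        refine ⟨algebraMap R _ (s : R) ^ 2 * α, Ideal.mul_mem_left _ _ hα, β, hβ, ?_⟩
        rw [hz0, mul_pow, hz, mul_assoc]
      · apply htriv
        intro hle
        apply hPp
        have h1 : P ^ N' ≤ p := by
          refine le_trans ?_ hle
          rw [← Ideal.map_le_iff_le_comap, Ideal.map_pow, hmP]
          exact hJ
        have h2 : P ≤ p := Ideal.IsPrime.le_of_pow_le h1
        exact le_antisymm h2 (hpm.2 ⟨hP, hIP⟩ h2)
  · refine ⟨q, 1, fun r hr => by simpa using hr, fun p hp hpm hpg => ?_⟩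
    apply htriv
    intro hle
    apply hgood
    have h2 : q.radical ≤ p := (Ideal.IsPrime.radical_le_iff hp).mpr hle
    have h3 : q.radical = p := le_antisymm h2 (hpm.2 ⟨hP, hIP⟩ h2)
    subst h3
    exact ⟨hpm, hpg⟩

theorem family {R : Type u} [CommRing R] [IsNoetherianRing R] (I : Ideal R) :
    ∃ (r : ℕ) (L : Fin r → Ideal R) (z : Fin r → R), (∀ a, (∀ i, a * z i ∈ L i) → a ∈ I) ∧
      ∀ (p : Ideal R) (hp : p.IsPrime), p ∈ I.minimalPrimes → @LIC.GoodPrime R _ p hp → ∀ i,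
        ∃ α ∈ (L i).map (algebraMap R (Localization.AtPrime p)),
        ∃ β ∈ (L i).map (algebraMap R (Localization.AtPrime p)),
          algebraMap R (Localization.AtPrime p) (z i) ^ 2 = α * β := by
  obtain ⟨t, ht, hprim⟩ := Ideal.isLasker R R I
  have hle : ∀ q ∈ t, I ≤ q := fun q hq => ht ▸ Finset.inf_le (f := id) hq
  have hp := fun i : Fin t.card => piece I (t.equivFin.symm i).1 (hle _ (t.equivFin.symm i).2)
    (hprim (t.equivFin.symm i).2)
  choose L z h1 h2 using hp
  refine ⟨t.card, L, z, ?_, fun p hp hpm hpg i => h2 i p hp hpm hpg⟩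
  intro a ha
  rw [← ht, Submodule.mem_finsetInf]
  intro q hq
  have := h1 (t.equivFin ⟨q, hq⟩) a (ha _)
  simpa using this
end

end LICP

namespace LICP

section
universe u

theorem le_freeIC {R : Type*} [CommRing R] {ι : Type*} (U : Submodule R (ι →₀ R)) :
    U ≤ LIC.freeIC U := by
  intro x hx
  change IsIntegral (Algebra.adjoin R (LIC.symEmb R ι '' U)) (LIC.symEmb R ι x)
  exact isIntegral_algebraMap (R := Algebra.adjoin R (LIC.symEmb R ι '' U))
    (x := ⟨LIC.symEmb R ι x, Algebra.subset_adjoin ⟨x, hx, rfl⟩⟩)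

theorem single_mem_freeIC {R : Type*} [CommRing R] {ι : Type*} (U : Submodule R (ι →₀ R)) (j : ι)
    (z α β : R) (hα : Finsupp.single j α ∈ U) (hβ : Finsupp.single j β ∈ U)
    (hz : z ^ 2 = α * β) : Finsupp.single j z ∈ LIC.freeIC U := by
  have hs : ∀ c : R, LIC.symEmb R ι (Finsupp.single j c) = c • MvPolynomial.X j := fun c => by
    simp [LIC.symEmb]
  change IsIntegral (Algebra.adjoin R (LIC.symEmb R ι '' U)) (LIC.symEmb R ι (Finsupp.single j z))
  have hmem : LIC.symEmb R ι (Finsupp.single j z) ^ 2 ∈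
      Algebra.adjoin R (LIC.symEmb R ι '' U) := by
    have : LIC.symEmb R ι (Finsupp.single j z) ^ 2 =
        LIC.symEmb R ι (Finsupp.single j α) * LIC.symEmb R ι (Finsupp.single j β) := by
      rw [hs, hs, hs, smul_pow, smul_mul_smul_comm, hz, pow_two]
    rw [this]
    exact mul_mem (Algebra.subset_adjoin ⟨_, hα, rfl⟩) (Algebra.subset_adjoin ⟨_, hβ, rfl⟩)
  exact IsIntegral.of_pow (n := 2) (by norm_num)
    (isIntegral_algebraMap (R := Algebra.adjoin R (LIC.symEmb R ι '' U)) (x := ⟨_, hmem⟩))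

theorem descend {R X H M : Type*} [CommRing R] [AddCommGroup X] [Module R X] [AddCommGroup H]
    [Module R H] [AddCommGroup M] [Module R M] (Φ : X →ₗ[R] H) (Ω : X →ₗ[R] M)
    (hker : LinearMap.ker Φ ≤ LinearMap.ker Ω) (hsurj : Function.Surjective Ω) :
    ∃ φ : LinearMap.range Φ →ₗ[R] M, Function.Surjective φ ∧
      LinearMap.ker φ = Submodule.comap (LinearMap.range Φ).subtype ((LinearMap.ker Ω).map Φ) := by
  let φ : LinearMap.range Φ →ₗ[R] M :=
    (LinearMap.ker Φ).liftQ Ω hker ∘ₗ Φ.quotKerEquivRange.symm.toLinearMap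
  have hφ : ∀ x, φ ⟨Φ x, LinearMap.mem_range_self Φ x⟩ = Ω x := by
    intro x
    have : (⟨Φ x, LinearMap.mem_range_self Φ x⟩ : LinearMap.range Φ) =
        Φ.quotKerEquivRange (Submodule.Quotient.mk x) := rfl
    rw [this]
    simp [φ]
  refine ⟨φ, ?_, ?_⟩
  · intro y
    obtain ⟨x, rfl⟩ := hsurj y
    exact ⟨_, hφ x⟩
  · ext ⟨_, x, rfl⟩
    rw [LinearMap.mem_ker, hφ, Submodule.mem_comap]
    constructor
    · intro h
      exact ⟨x, h, rfl⟩
    · rintro ⟨y, hy, hxy⟩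
      have h1 : y - x ∈ LinearMap.ker Ω := hker (by
        rw [LinearMap.mem_ker, map_sub, hxy]; exact sub_self _)
      have h2 := sub_mem hy h1
      rwa [sub_sub_cancel] at h2

theorem main {R : Type u} [CommRing R]
    [IsNoetherianRing R] (M : Type u) [AddCommGroup M] [Module R M] [Module.Finite R M] :
    ∃ (n : ℕ) (L T : Submodule R (Fin n →₀ R)), L ≤ T ∧ L.FG ∧ T.FG ∧
      (∃ φ : ↥T →ₗ[R] M, Function.Surjective φ ∧
        LinearMap.ker φ = Submodule.comap T.subtype L) ∧
      ∀ (p : Ideal R) (hp : p.IsPrime), p ∈ (Module.annihilator R M).minimalPrimes →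
        @LIC.GoodPrime R _ p hp → @LIC.LocalizedIntegral R _ p hp n L T := by
  obtain ⟨r, Lf, z, hI, hloc⟩ := family (Module.annihilator R M)
  obtain ⟨g, π, hπ⟩ := Module.Finite.exists_fin' R M
  obtain ⟨e⟩ : Nonempty (Fin g × Fin r ≃ Fin (g * r)) := ⟨finProdFinEquiv⟩
  obtain ⟨ψ, hψ⟩ : ∃ ψ : (Fin g → R) →ₗ[R] (Fin (g * r) →₀ R),
      ∀ v j, ψ v j = z (e.symm j).2 * v (e.symm j).1 :=
    ⟨(Finsupp.linearEquivFunOnFinite R R (Fin (g * r))).symm.toLinearMap ∘ₗ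
      LinearMap.pi (fun j => z (e.symm j).2 • LinearMap.proj (e.symm j).1), fun v j => rfl⟩
  obtain ⟨L0, hL0⟩ : ∃ L0 : Submodule R (Fin (g * r) →₀ R),
      ∀ x, x ∈ L0 ↔ ∀ j, x j ∈ Lf (e.symm j).2 :=
    ⟨{ carrier := {x | ∀ j, x j ∈ Lf (e.symm j).2}
       zero_mem' := fun j => by simp
       add_mem' := fun {a b} ha hb j => by
         rw [Finsupp.add_apply]; exact add_mem (ha j) (hb j)
       smul_mem' := fun c x hx j => by
         rw [Finsupp.smul_apply]; exact Submodule.smul_mem _ _ (hx j) }, fun x => Iff.rfl⟩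
  obtain ⟨Φ, hΦ⟩ : ∃ Φ : (L0 × (Fin g → R)) →ₗ[R] (Fin (g * r) →₀ R),
      ∀ l v, Φ (l, v) = l + ψ v := ⟨L0.subtype.coprod ψ, fun l v => rfl⟩
  obtain ⟨Ω, hΩ⟩ : ∃ Ω : (L0 × (Fin g → R)) →ₗ[R] M, ∀ l v, Ω (l, v) = π v :=
    ⟨π ∘ₗ LinearMap.snd R _ _, fun l v => rfl⟩
  have hker : LinearMap.ker Φ ≤ LinearMap.ker Ω := by
    rintro ⟨l, v⟩ h
    rw [LinearMap.mem_ker, hΦ] at h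
    rw [LinearMap.mem_ker, hΩ]
    have hv : ∀ k, v k ∈ Module.annihilator R M := by
      intro k
      apply hI
      intro i
      have h1 : ψ v = - (l : Fin (g * r) →₀ R) := eq_neg_of_add_eq_zero_right h
      have h2 : ψ v ∈ L0 := h1 ▸ neg_mem l.2
      have h3 := (hL0 _).mp h2 (e (k, i))
      rw [hψ] at h3
      simpa [mul_comm] using h3
    have hsum : v = ∑ k, v k • (Pi.single k 1 : Fin g → R) := by
      ext k; simp [Finset.sum_apply, Pi.single_apply]
    rw [hsum, map_sum]
    refine Finset.sum_eq_zero fun k _ => ?_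
    rw [map_smul]
    exact Module.mem_annihilator.mp (hv k) _
  have hsurj : Function.Surjective Ω := by
    intro y
    obtain ⟨v, rfl⟩ := hπ y
    exact ⟨(0, v), hΩ 0 v⟩
  have hd := descend (R := R) (X := L0 × (Fin g → R)) (H := Fin (g * r) →₀ R) (M := M) Φ Ω hker hsurj
  have hle : (LinearMap.ker Ω).map Φ ≤ LinearMap.range Φ := LinearMap.map_le_range
  have hfg : ∀ W : Submodule R (Fin (g * r) →₀ R), W.FG := fun W => IsNoetherian.noetherian W
  refine ⟨g * r, (LinearMap.ker Ω).map Φ, LinearMap.range Φ, hle, hfg _, hfg _, hd, ?_⟩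
  · intro p hp hpm hpg
    have hloc' := hloc p hp hpm hpg
    set U := Submodule.span (Localization.AtPrime p) (LIC.locMap p (g * r) ''
      ((LinearMap.ker Ω).map Φ : Set (Fin (g * r) →₀ R))) with hU
    have hL0U : ∀ l ∈ L0, LIC.locMap p (g * r) l ∈ U := by
      intro l hl
      refine Submodule.subset_span ⟨l, ⟨(⟨l, hl⟩, 0), ?_, ?_⟩, rfl⟩
      · rw [SetLike.mem_coe, LinearMap.mem_ker, hΩ, map_zero]
      · rw [hΦ, map_zero, add_zero]
    have hlm : ∀ x j, LIC.locMap p (g * r) x j = algebraMap R (Localization.AtPrime p) (x j) :=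
      fun x j => rfl
    have hsingle : ∀ j, ∀ α ∈ (Lf (e.symm j).2).map (algebraMap R (Localization.AtPrime p)),
        Finsupp.single j α ∈ U := by
      intro j α hα
      have hle : (Lf (e.symm j).2).map (algebraMap R (Localization.AtPrime p)) ≤
          U.comap (Finsupp.lsingle j) := by
        refine Submodule.span_le.mpr ?_
        rintro _ ⟨a, ha, rfl⟩
        have h1 := hL0U (Finsupp.single j a) (by
          rw [hL0]
          intro j'
          by_cases hj : j = j'
          · subst hj; simpa using ha
          · rw [Finsupp.single_eq_of_ne (Ne.symm hj)]; exact zero_mem _)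
        have h2 : LIC.locMap p (g * r) (Finsupp.single j a) =
            Finsupp.single j (algebraMap R (Localization.AtPrime p) a) := by
          simp [LIC.locMap]
        rw [h2] at h1
        exact h1
      exact hle hα
    rintro _ ⟨⟨l, v⟩, rfl⟩
    rw [hΦ, map_add]
    refine add_mem (le_freeIC U (hL0U _ l.2)) ?_
    have hsum : LIC.locMap p (g * r) (ψ v) =
        ∑ j, algebraMap R (Localization.AtPrime p) (v (e.symm j).1) •
          Finsupp.single j (algebraMap R (Localization.AtPrime p) (z (e.symm j).2)) := by
      ext j
      rw [hlm, hψ, Finsupp.finsetSum_apply, Finset.sum_eq_single j]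
      · rw [map_mul, Finsupp.smul_apply, Finsupp.single_eq_same, smul_eq_mul, mul_comm]
      · intro b _ hb
        simp [hb.symm]
      · simp
    rw [hsum]
    refine sum_mem fun j _ => Submodule.smul_mem _ _ ?_
    obtain ⟨α, hα, β, hβ, hz⟩ := hloc' (e.symm j).2
    exact single_mem_freeIC U j _ α β (hsingle j α hα) (hsingle j β hβ) hz
end

end LICP

universe u

/-- Let `R` be Noetherian and `M` a finitely generated `R`-module.
Suppose some minimal prime `p` of the support of `M` (i.e. a minimal prime over
`ann M`) has `ht p ≥ 2` with `R_p` excellent, equidimensional and without embedded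
primes.  Then there are a finitely generated free module `H` and finitely generated
submodules `L ⊆ T ⊆ H` (hence torsionless) with `M ≅ T/L` (expressed by a surjection
`T → M` with kernel `L`) such that for every such prime `p`, `T_p` is integral over
`L_p` in `H_p`. -/
theorem finite_is_quotient_of_locally_integral_torsionless {R : Type u} [CommRing R]
    [IsNoetherianRing R] (M : Type u) [AddCommGroup M] [Module R M] [Module.Finite R M]
    (hA : ∃ p ∈ (Module.annihilator R M).minimalPrimes,
      ∃ hp : p.IsPrime, @LIC.GoodPrime R _ p hp) :
    ∃ (n : ℕ) (L T : Submodule R (Fin n →₀ R)), L ≤ T ∧ L.FG ∧ T.FG ∧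
      (∃ φ : ↥T →ₗ[R] M, Function.Surjective φ ∧
        LinearMap.ker φ = Submodule.comap T.subtype L) ∧
      ∀ (p : Ideal R) (hp : p.IsPrime), p ∈ (Module.annihilator R M).minimalPrimes →
        @LIC.GoodPrime R _ p hp → @LIC.LocalizedIntegral R _ p hp n L T := by
  exact LICP.main M
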